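/- arXiv:1210.5736 — 4 statements merged into one kernel-verified Lean document; each statement's English description precedes it below -/
import Mathlib

section
/- Let d ≥ 3 and let W = W_d be the universal Coxeter group on d generators x_1,…,x_d. Then there exists a descending chain W = H_0 ≥ H_1 ≥ H_2 ≥ ⋯ of normal subgroups of W such that (i) for every k ≥ 0 the index of H_k in W is 2^k, and (ii) for every real ε > 0 there exists k₀ such that for all k ≥ k₀, the rank of the elementary abelian 2-group H_k/([H_k, W]·H_k²) is at least ((d−2)/2 − ε)·k. -/
/-- The universal Coxeter group on `d` generators: `⟨x_1,…,x_d ∣ x_i² = 1⟩`,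
the free product of `d` copies of `ℤ/2ℤ`. -/
def UnivCoxeter (d : ℕ) : Type :=
  PresentedGroup {r : FreeGroup (Fin d) | ∃ i : Fin d, r = FreeGroup.of i ^ 2}

instance (d : ℕ) : Group (UnivCoxeter d) := by
  unfold UnivCoxeter; infer_instance

/-- For a subgroup `H` of a group `W`, the subgroup `[H,W]·H²` generated by all commutators
`[h,w]` (`h ∈ H`, `w ∈ W`) together with all squares of elements of `H`. -/
def commSq {W : Type*} [Group W] (H : Subgroup W) : Subgroup W :=
  ⁅H, (⊤ : Subgroup W)⁆ ⊔ Subgroup.closure ((fun g => g * g) '' (H : Set W))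

open scoped commutatorElement in
lemma map_commutator_sub_one {Γ R : Type*} [Group Γ] [Ring R] (e : Γ →* R) (g h : Γ) :
    e ⁅g, h⁆ - 1 = ((e g - 1) * (e h - 1) - (e h - 1) * (e g - 1)) * e (g⁻¹ * h⁻¹) := by
  have h1 : (e g - 1) * (e h - 1) - (e h - 1) * (e g - 1) = e (g * h) - e (h * g) := by
    rw [map_mul, map_mul]; noncomm_ring
  rw [h1, sub_mul, ← map_mul, ← map_mul, commutatorElement_def]
  congr 1
  · congr 1; group
  · rw [← map_one e]; congr 1; group

section Augmentation

variable {Γ R : Type*} [Group Γ] [Ring R] [Algebra (ZMod 2) R]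

/-- The span of the elements `e g - 1`; for the group algebra this is the augmentation ideal. -/
def augSpace (e : Γ →* R) : Submodule (ZMod 2) R :=
  Submodule.span (ZMod 2) (Set.range fun g => e g - 1)

variable (e : Γ →* R)

lemma sub_one_mem_augSpace (g : Γ) : e g - 1 ∈ augSpace e :=
  Submodule.subset_span ⟨g, rfl⟩

lemma sub_one_mem_augSpace_pow_one (g : Γ) : e g - 1 ∈ augSpace e ^ 1 := by
  rw [pow_one]; exact sub_one_mem_augSpace e g

lemma augSpace_mul_self_le : augSpace e * augSpace e ≤ augSpace e := by
  unfold augSpace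
  rw [Submodule.span_mul_span, Submodule.span_le]
  rintro _ ⟨_, ⟨g, rfl⟩, _, ⟨h, rfl⟩, rfl⟩
  have h1 : (e g - 1) * (e h - 1) = (e (g * h) - 1) - (e g - 1) - (e h - 1) := by
    rw [map_mul]; noncomm_ring
  have := sub_mem (sub_mem (sub_one_mem_augSpace e (g * h)) (sub_one_mem_augSpace e g))
    (sub_one_mem_augSpace e h)
  simp only [h1]
  exact this

lemma augSpace_pow_succ_le (n : ℕ) : augSpace e ^ (n + 2) ≤ augSpace e ^ (n + 1) := by
  rw [pow_add, pow_add _ n 1, pow_one, pow_two]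
  exact mul_le_mul_right (augSpace_mul_self_le e) _

lemma augSpace_pow_anti {m n : ℕ} (h : m ≤ n) : augSpace e ^ (n + 1) ≤ augSpace e ^ (m + 1) := by
  induction n, h using Nat.le_induction with
  | base => exact le_rfl
  | succ n _ ih => exact (augSpace_pow_succ_le e n).trans ih

lemma mul_mem_augSpace_pow {a b c : ℕ} {x y : R} (hx : x ∈ augSpace e ^ a)
    (hy : y ∈ augSpace e ^ b) (hc : a + b = c) : x * y ∈ augSpace e ^ c := by
  rw [← hc, pow_add]; exact Submodule.mul_mem_mul hx hy

lemma map_mul_mem_augSpace_pow (g : Γ) {n : ℕ} {x : R} (hx : x ∈ augSpace e ^ (n + 1)) :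
    e g * x ∈ augSpace e ^ (n + 1) := by
  have h2 := augSpace_pow_succ_le e n
    (mul_mem_augSpace_pow e (sub_one_mem_augSpace_pow_one e g) hx (by ring))
  have : e g * x = (e g - 1) * x + x := by noncomm_ring
  rw [this]; exact add_mem h2 hx

lemma mul_map_mem_augSpace_pow (g : Γ) {n : ℕ} {x : R} (hx : x ∈ augSpace e ^ (n + 1)) :
    x * e g ∈ augSpace e ^ (n + 1) := by
  have h2 := augSpace_pow_succ_le e n
    (mul_mem_augSpace_pow e hx (sub_one_mem_augSpace_pow_one e g) (by ring))
  have : x * e g = x * (e g - 1) + x := by noncomm_ring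
  rw [this]; exact add_mem h2 hx

/-- The dimension subgroup `{g | e g - 1 ∈ I ^ (n + 1)}`; note the shift of the index. -/
def dimSubgroup (n : ℕ) : Subgroup Γ where
  carrier := {g | e g - 1 ∈ augSpace e ^ (n + 1)}
  one_mem' := by simp
  mul_mem' {g h} hg hh := by
    have : e (g * h) - 1 = e g * (e h - 1) + (e g - 1) := by rw [map_mul]; noncomm_ring
    simp only [Set.mem_ofPred_eq] at *
    rw [this]
    exact add_mem (map_mul_mem_augSpace_pow e g hh) hg
  inv_mem' {g} hg := by
    have : e g⁻¹ - 1 = -(e g⁻¹ * (e g - 1)) := by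
      rw [mul_sub, ← map_mul]; simp
    simp only [Set.mem_ofPred_eq] at *
    rw [this]
    exact neg_mem (map_mul_mem_augSpace_pow e _ hg)

lemma mem_dimSubgroup {n : ℕ} {g : Γ} :
    g ∈ dimSubgroup e n ↔ e g - 1 ∈ augSpace e ^ (n + 1) := Iff.rfl

lemma sub_one_mul_sub_one_mem {a b c : ℕ} {g h : Γ} (hg : g ∈ dimSubgroup e a)
    (hh : h ∈ dimSubgroup e b) (hc : a + b + 2 = c) :
    (e g - 1) * (e h - 1) ∈ augSpace e ^ c :=
  mul_mem_augSpace_pow e ((mem_dimSubgroup e).1 hg) ((mem_dimSubgroup e).1 hh) (by omega)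

instance dimSubgroup_normal (n : ℕ) : (dimSubgroup e n).Normal where
  conj_mem g hg h := by
    rw [mem_dimSubgroup] at *
    have : e (h * g * h⁻¹) - 1 = e h * (e g - 1) * e h⁻¹ := by
      rw [mul_sub, sub_mul, map_mul, map_mul, mul_one, ← map_mul e h h⁻¹]; simp
    rw [this]
    exact mul_map_mem_augSpace_pow e _ (map_mul_mem_augSpace_pow e _ hg)

lemma dimSubgroup_zero : dimSubgroup e 0 = ⊤ := by
  ext g; simp [mem_dimSubgroup, sub_one_mem_augSpace]

lemma dimSubgroup_anti : Antitone (dimSubgroup e) := fun _ _ h _ hg => augSpace_pow_anti e h hg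

open scoped commutatorElement in
lemma commutator_sub_mem {a b : ℕ} {g h : Γ} (hg : g ∈ dimSubgroup e a)
    (hh : h ∈ dimSubgroup e b) :
    (e ⁅g, h⁆ - 1) - ((e g - 1) * (e h - 1) - (e h - 1) * (e g - 1)) ∈
      augSpace e ^ (a + b + 3) := by
  rw [map_commutator_sub_one]
  set c := (e g - 1) * (e h - 1) - (e h - 1) * (e g - 1) with hc
  have hcm : c ∈ augSpace e ^ (a + b + 2) := by
    refine sub_mem ?_ ?_
    · exact sub_one_mul_sub_one_mem e hg hh (by ring)
    · exact sub_one_mul_sub_one_mem e hh hg (by ring)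
  have : c * e (g⁻¹ * h⁻¹) - c = c * (e (g⁻¹ * h⁻¹) - 1) := by noncomm_ring
  rw [this]
  exact mul_mem_augSpace_pow e hcm (sub_one_mem_augSpace_pow_one e _) (by ring)

open scoped commutatorElement in
lemma commutator_mem_dimSubgroup {a b : ℕ} {g h : Γ} (hg : g ∈ dimSubgroup e a)
    (hh : h ∈ dimSubgroup e b) : ⁅g, h⁆ ∈ dimSubgroup e (a + b + 1) := by
  rw [mem_dimSubgroup, map_commutator_sub_one]
  refine mul_map_mem_augSpace_pow e _ (sub_mem ?_ ?_)
  · exact sub_one_mul_sub_one_mem e hg hh (by ring)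
  · exact sub_one_mul_sub_one_mem e hh hg (by ring)

lemma add_self_eq_zero_of_algebra (x : R) : x + x = 0 := by
  have h : (2 : ZMod 2) = 0 := by decide
  rw [← two_smul (ZMod 2) x, h, zero_smul]

lemma map_mul_self_sub_one (g : Γ) : e (g * g) - 1 = (e g - 1) * (e g - 1) := by
  have h : (e g - 1) * (e g - 1) = (e (g * g) - 1) - ((e g - 1) + (e g - 1)) := by
    rw [map_mul]; noncomm_ring
  rw [h, add_self_eq_zero_of_algebra, sub_zero]

lemma mul_self_mem_dimSubgroup {a : ℕ} {g : Γ} (hg : g ∈ dimSubgroup e a) :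
    g * g ∈ dimSubgroup e (2 * a + 1) := by
  rw [mem_dimSubgroup, map_mul_self_sub_one]
  exact sub_one_mul_sub_one_mem e hg hg (by ring)

/-- For `M` between consecutive dimension subgroups, `g ↦ e g - 1` is a homomorphism modulo the
next power of the augmentation ideal. -/
def layerHom {n : ℕ} (M : Subgroup Γ) (hM : M ≤ dimSubgroup e n) :
    M →* Multiplicative (R ⧸ augSpace e ^ (n + 2)) where
  toFun g := .ofAdd (Submodule.Quotient.mk (e g - 1))
  map_one' := by simp
  map_mul' g h := by
    rw [← ofAdd_add, ← Submodule.Quotient.mk_add]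
    congr 1
    rw [Submodule.Quotient.eq]
    have : e ((g * h : M) : Γ) - 1 - (e g - 1 + (e h - 1)) = (e g - 1) * (e h - 1) := by
      rw [Subgroup.coe_mul, map_mul]; noncomm_ring
    rw [this]
    exact augSpace_pow_anti e (by omega : n + 1 ≤ n + n + 1)
      (sub_one_mul_sub_one_mem e (hM g.2) (hM h.2) (by ring))

lemma layerHom_apply {n : ℕ} (M : Subgroup Γ) (hM : M ≤ dimSubgroup e n) (g : M) :
    layerHom e M hM g = .ofAdd (Submodule.Quotient.mk (e g - 1)) := rfl

lemma ker_layerHom {n : ℕ} (M : Subgroup Γ) (hM : M ≤ dimSubgroup e n) :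
    (layerHom e M hM).ker = (dimSubgroup e (n + 1)).subgroupOf M := by
  ext g
  rw [MonoidHom.mem_ker, layerHom_apply, Subgroup.mem_subgroupOf, mem_dimSubgroup, ofAdd_eq_one,
    Submodule.Quotient.mk_eq_zero]

/-- The image of `layerHom`, as a subspace. -/
def layerSpace {n : ℕ} (M : Subgroup Γ) (hM : M ≤ dimSubgroup e n) :
    Submodule (ZMod 2) (R ⧸ augSpace e ^ (n + 2)) :=
  AddSubgroup.toZModSubmodule 2 (MonoidHom.toAdditiveLeft (layerHom e M hM)).range

lemma mem_layerSpace {n : ℕ} (M : Subgroup Γ) (hM : M ≤ dimSubgroup e n)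
    {x : R ⧸ augSpace e ^ (n + 2)} :
    x ∈ layerSpace e M hM ↔ ∃ g ∈ M, Submodule.Quotient.mk (e g - 1) = x := by
  constructor
  · rintro ⟨g, rfl⟩
    exact ⟨g.toMul, g.toMul.2, rfl⟩
  · rintro ⟨g, hg, rfl⟩
    exact ⟨.ofMul ⟨g, hg⟩, rfl⟩

lemma relIndex_eq_card_layerSpace {n : ℕ} (M : Subgroup Γ) (hM : M ≤ dimSubgroup e n) :
    (dimSubgroup e (n + 1)).relIndex M = Nat.card (layerSpace e M hM) := by
  rw [Subgroup.relIndex, ← ker_layerHom e M hM, Subgroup.index_ker]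
  rfl

lemma relIndex_eq_two_pow {n : ℕ} [Module.Finite (ZMod 2) (R ⧸ augSpace e ^ (n + 2))]
    (M : Subgroup Γ) (hM : M ≤ dimSubgroup e n) :
    (dimSubgroup e (n + 1)).relIndex M =
      2 ^ Module.finrank (ZMod 2) (layerSpace e M hM) := by
  rw [relIndex_eq_card_layerSpace e M hM, Module.natCard_eq_pow_finrank (K := ZMod 2)]
  simp

/-- Lifts to `M` of a basis of the layer of `M`. -/
lemma exists_layer_basis {n : ℕ} [Module.Finite (ZMod 2) (R ⧸ augSpace e ^ (n + 2))]
    (M : Subgroup Γ) (hM : M ≤ dimSubgroup e n) :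
    ∃ b : Fin (Module.finrank (ZMod 2) (layerSpace e M hM)) → Γ, (∀ j, b j ∈ M) ∧
      ∀ g ∈ M, e g - 1 ∈ Submodule.span (ZMod 2) (Set.range fun j => e (b j) - 1) ⊔
        augSpace e ^ (n + 2) := by
  set B := Module.finBasis (ZMod 2) (layerSpace e M hM)
  have hb : ∀ j, ∃ g ∈ M, Submodule.Quotient.mk (e g - 1) =
      (B j : R ⧸ augSpace e ^ (n + 2)) := fun j => (mem_layerSpace e M hM).1 (B j).2
  choose b hbM hb using hb
  refine ⟨b, hbM, fun g hg => ?_⟩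
  have hg' : (Submodule.Quotient.mk (e g - 1) : R ⧸ augSpace e ^ (n + 2)) ∈
      layerSpace e M hM := (mem_layerSpace e M hM).2 ⟨g, hg, rfl⟩
  have h1 := congrArg Subtype.val (B.sum_repr ⟨_, hg'⟩)
  simp only [AddSubmonoidClass.coe_finsetSum, Submodule.coe_smul, ← hb] at h1
  have h2 : (Submodule.Quotient.mk (∑ j, B.repr ⟨_, hg'⟩ j • (e (b j) - 1)) :
      R ⧸ augSpace e ^ (n + 2)) = Submodule.Quotient.mk (e g - 1) := by
    exact (map_sum (Submodule.mkQ _) _ _).trans h1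
  rw [eq_comm, Submodule.Quotient.eq] at h2
  rw [← add_sub_cancel (∑ j, B.repr ⟨_, hg'⟩ j • (e (b j) - 1)) (e g - 1)]
  exact Submodule.add_mem_sup (Submodule.sum_mem _ fun j _ =>
    Submodule.smul_mem _ _ (Submodule.subset_span ⟨j, rfl⟩)) h2

end Augmentation

section Sorting

variable {β k R : Type*} [CommRing k] [Ring R] [Algebra k R]

/-- The span of the products of fewer than `n` of the `y b`, of total weight `m`, modulo
`I ^ (m + 1)`. -/
def shortSpan (I : Submodule k R) (y : β → R) (w : β → ℕ) (n m : ℕ) : Submodule k R :=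
  Submodule.span k {x | ∃ l : List β, l.length < n ∧ (l.map w).sum = m ∧ (l.map y).prod = x} ⊔
    I ^ (m + 1)

variable {I : Submodule k R} {y : β → R} {w : β → ℕ}

lemma prod_mem_pow (hy : ∀ b, y b ∈ I ^ w b) (l : List β) :
    (l.map y).prod ∈ I ^ (l.map w).sum := by
  induction l with
  | nil => simpa using ⟨1, map_one _⟩
  | cons a l ih =>
    simp only [List.map_cons, List.prod_cons, List.sum_cons, pow_add]
    exact Submodule.mul_mem_mul (hy a) ih

lemma mul_mem_shortSpan (hy : ∀ b, y b ∈ I ^ w b) {n m : ℕ} {x : R} (a : β)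
    (hx : x ∈ shortSpan I y w n m) : y a * x ∈ shortSpan I y w (n + 1) (w a + m) := by
  obtain ⟨u, hu, v, hv, rfl⟩ := Submodule.mem_sup.1 hx
  rw [mul_add]
  refine Submodule.add_mem_sup ?_ ?_
  · clear hx
    induction hu using Submodule.span_induction with
    | mem x h =>
      obtain ⟨l, hl, hm, rfl⟩ := h
      exact Submodule.subset_span ⟨a :: l, by simpa using hl, by simp [hm], by simp⟩
    | zero => simp
    | add x x' _ _ h h' =>
      rw [mul_add]; exact add_mem h h'
    | smul c x _ h =>
      rw [mul_smul_comm]; exact Submodule.smul_mem _ _ h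
  · rw [add_assoc, pow_add]; exact Submodule.mul_mem_mul (hy a) hv

lemma mul_prod_mem_shortSpan (hy : ∀ b, y b ∈ I ^ w b) {v : ℕ} {x : R} (l : List β)
    (hx : x ∈ Submodule.span k {x | ∃ c, w c = v ∧ y c = x} ⊔ I ^ (v + 1)) :
    x * (l.map y).prod ∈ shortSpan I y w (l.length + 2) (v + (l.map w).sum) := by
  obtain ⟨u, hu, z, hz, rfl⟩ := Submodule.mem_sup.1 hx
  rw [add_mul]
  refine Submodule.add_mem_sup ?_ ?_
  · clear hx
    induction hu using Submodule.span_induction with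
    | mem x h =>
      obtain ⟨c, hc, rfl⟩ := h
      exact Submodule.subset_span ⟨c :: l, by simp, by simp [hc], by simp⟩
    | zero => simp
    | add x x' _ _ h h' =>
      rw [add_mul]; exact add_mem h h'
    | smul c x _ h =>
      rw [smul_mul_assoc]; exact Submodule.smul_mem _ _ h
  · rw [add_right_comm, pow_add]; exact Submodule.mul_mem_mul hz (prod_mem_pow hy l)

lemma prod_sub_prod_mem_shortSpan (hy : ∀ b, y b ∈ I ^ w b)
    (hcomm : ∀ b c, y b * y c - y c * y b ∈
      Submodule.span k {x | ∃ a, w a = w b + w c ∧ y a = x} ⊔ I ^ (w b + w c + 1))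
    {l l' : List β} (h : l.Perm l') :
    (l.map y).prod - (l'.map y).prod ∈ shortSpan I y w l.length (l.map w).sum := by
  induction h with
  | nil => simp
  | cons a _ ih =>
    simp only [List.map_cons, List.prod_cons, List.sum_cons, List.length_cons, ← mul_sub]
    exact mul_mem_shortSpan hy a ih
  | swap a b l =>
    simp only [List.map_cons, List.prod_cons, List.sum_cons, List.length_cons, ← mul_assoc,
      ← sub_mul, ← add_assoc]
    exact mul_prod_mem_shortSpan hy l (hcomm _ _)
  | trans h1 h2 ih1 ih2 =>
    rw [← sub_add_sub_cancel]
    refine add_mem ih1 ?_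
    rwa [h1.length_eq, (h1.map w).sum_eq]

/-- The ordered product of the `y b`, `b ∈ s`. -/
def sortedProd [LinearOrder β] (y : β → R) (s : Finset β) : R := ((s.sort (· ≤ ·)).map y).prod

lemma sum_map_sort [LinearOrder β] (w : β → ℕ) (s : Finset β) :
    ((s.sort (· ≤ ·)).map w).sum = ∑ b ∈ s, w b := by
  rw [← Multiset.sum_coe, ← Multiset.map_coe, Finset.sort_eq]
  rfl

lemma sortedProd_mem_pow [LinearOrder β] (hy : ∀ b, y b ∈ I ^ w b) (s : Finset β) :
    sortedProd y s ∈ I ^ ∑ b ∈ s, w b := by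
  rw [← sum_map_sort]
  exact prod_mem_pow hy _

/-- Every product of weight `m` is a combination of ordered products of weight `m`, modulo
`I ^ (m + 1)`. -/
lemma prod_mem_span_sortedProd [LinearOrder β] (hy : ∀ b, y b ∈ I ^ w b)
    (hcomm : ∀ b c, y b * y c - y c * y b ∈
      Submodule.span k {x | ∃ a, w a = w b + w c ∧ y a = x} ⊔ I ^ (w b + w c + 1))
    (hsq : ∀ b, y b * y b ∈
      Submodule.span k {x | ∃ a, w a = w b + w b ∧ y a = x} ⊔ I ^ (w b + w b + 1))
    (l : List β) :
    (l.map y).prod ∈ Submodule.span k {x | ∃ s : Finset β, ∑ b ∈ s, w b = (l.map w).sum ∧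
      sortedProd y s = x} ⊔ I ^ ((l.map w).sum + 1) := by
  induction hn : l.length using Nat.strong_induction_on generalizing l with
  | _ n ih =>
    have key : ∀ m, shortSpan I y w n m ≤ Submodule.span k {x | ∃ s : Finset β,
        ∑ b ∈ s, w b = m ∧ sortedProd y s = x} ⊔ I ^ (m + 1) := by
      intro m
      refine sup_le (Submodule.span_le.2 ?_) le_sup_right
      rintro _ ⟨l', hl', rfl, rfl⟩
      exact ih _ hl' l' rfl
    by_cases hd : l.Nodup
    · have hp : l.Perm (l.toFinset.sort (· ≤ ·)) :=
        ((Finset.sort_perm_toList _ _).trans (List.toFinset_toList hd)).symm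
      have h1 := key _ (hn ▸ prod_sub_prod_mem_shortSpan hy hcomm hp)
      rw [← sub_add_cancel (l.map y).prod ((l.toFinset.sort (· ≤ ·)).map y).prod]
      refine add_mem h1 (Submodule.mem_sup_left (Submodule.subset_span ⟨l.toFinset, ?_, rfl⟩))
      rw [← sum_map_sort, (hp.map w).sum_eq]
    · obtain ⟨a, ha⟩ := List.exists_duplicate_iff_not_nodup.2 hd
      obtain ⟨l', hp⟩ := (List.duplicate_iff_sublist.1 ha).exists_perm_append
      have h1 := key _ (hn ▸ prod_sub_prod_mem_shortSpan hy hcomm hp)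
      have h2 := mul_prod_mem_shortSpan hy l' (hsq a)
      have hlen : l'.length + 2 = n := by rw [← hn, hp.length_eq]; simp
      have hsum : w a + w a + (l'.map w).sum = (l.map w).sum := by
        rw [(hp.map w).sum_eq]; simp [add_assoc]
      rw [hlen, hsum] at h2
      rw [← sub_add_cancel (l.map y).prod (([a, a] ++ l').map y).prod]
      refine add_mem h1 ?_
      simpa [mul_assoc] using key _ h2

end Sorting

section LayerBasis

variable {Γ R : Type*} [Group Γ] [Ring R] [Algebra (ZMod 2) R]

/-- Group elements which, for each `n`, span the `n`-th layer of the filtration by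
dimension subgroups. -/
structure LayerSpanning {β : Type*} (e : Γ →* R) (lay : β → ℕ) (b : β → Γ) : Prop where
  mem : ∀ i, b i ∈ dimSubgroup e (lay i)
  span : ∀ n, ∀ g ∈ dimSubgroup e n,
    e g - 1 ∈ Submodule.span (ZMod 2) {x | ∃ i, lay i + 1 = n + 1 ∧ e (b i) - 1 = x} ⊔
      augSpace e ^ (n + 2)

variable {e : Γ →* R} {β : Type*} {lay : β → ℕ} {b : β → Γ}

namespace LayerSpanning

lemma mem_pow (h : LayerSpanning e lay b) (i : β) :
    e (b i) - 1 ∈ augSpace e ^ (lay i + 1) := h.mem i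

open scoped commutatorElement in
lemma comm (h : LayerSpanning e lay b) (i j : β) :
    (e (b i) - 1) * (e (b j) - 1) - (e (b j) - 1) * (e (b i) - 1) ∈
      Submodule.span (ZMod 2) {x | ∃ a, lay a + 1 = lay i + 1 + (lay j + 1) ∧ e (b a) - 1 = x} ⊔
        augSpace e ^ (lay i + 1 + (lay j + 1) + 1) := by
  have h1 := commutator_sub_mem e (h.mem i) (h.mem j)
  have h2 := h.span _ _ (commutator_mem_dimSubgroup e (h.mem i) (h.mem j))
  rw [show lay i + 1 + (lay j + 1) = lay i + lay j + 1 + 1 by ring]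
  rw [← sub_sub_cancel (e ⁅b i, b j⁆ - 1) (_ - _)]
  exact sub_mem h2 (Submodule.mem_sup_right h1)

lemma sq (h : LayerSpanning e lay b) (i : β) :
    (e (b i) - 1) * (e (b i) - 1) ∈
      Submodule.span (ZMod 2) {x | ∃ a, lay a + 1 = lay i + 1 + (lay i + 1) ∧ e (b a) - 1 = x} ⊔
        augSpace e ^ (lay i + 1 + (lay i + 1) + 1) := by
  have h2 := h.span _ _ (mul_self_mem_dimSubgroup e (h.mem i))
  rw [show lay i + 1 + (lay i + 1) = 2 * lay i + 1 + 1 by ring, ← map_mul_self_sub_one]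
  exact h2

lemma augSpace_le (h : LayerSpanning e lay b) :
    augSpace e ≤ Submodule.span (ZMod 2) {x | ∃ i, lay i + 1 = 1 ∧ e (b i) - 1 = x} ⊔
      augSpace e ^ 2 := by
  conv_lhs => rw [augSpace]
  rw [Submodule.span_le]
  rintro _ ⟨g, rfl⟩
  exact h.span 0 g (by simp [dimSubgroup_zero])

lemma pow_le_span_prod (h : LayerSpanning e lay b) (m : ℕ) :
    augSpace e ^ m ≤ Submodule.span (ZMod 2) {x | ∃ l : List β,
      (l.map fun i => lay i + 1).sum = m ∧ (l.map fun i => e (b i) - 1).prod = x} ⊔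
      augSpace e ^ (m + 1) := by
  induction m with
  | zero =>
    refine le_sup_of_le_left ?_
    rw [pow_zero, Submodule.one_eq_span, Submodule.span_le, Set.singleton_subset_iff]
    exact Submodule.subset_span ⟨[], by simp⟩
  | succ m ih =>
    set A := Submodule.span (ZMod 2) {x | ∃ l : List β,
      (l.map fun i => lay i + 1).sum = m ∧ (l.map fun i => e (b i) - 1).prod = x} with hA
    have hA' : A ≤ augSpace e ^ m := by
      rw [hA, Submodule.span_le]
      rintro _ ⟨l, rfl, rfl⟩
      exact prod_mem_pow h.mem_pow l
    calc augSpace e ^ (m + 1) = augSpace e ^ m * augSpace e := pow_succ _ _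
      _ ≤ (A ⊔ augSpace e ^ (m + 1)) * augSpace e := mul_le_mul_left ih _
      _ = A * augSpace e ⊔ augSpace e ^ (m + 1 + 1) := by rw [Submodule.sup_mul, ← pow_succ]
      _ ≤ _ := by
        refine sup_le ((mul_le_mul_right h.augSpace_le _).trans ?_) le_sup_right
        rw [Submodule.mul_sup]
        refine sup_le_sup ?_ ?_
        · rw [hA, Submodule.span_mul_span, Submodule.span_le]
          rintro _ ⟨_, ⟨l, rfl, rfl⟩, _, ⟨i, hi, rfl⟩, rfl⟩
          exact Submodule.subset_span ⟨l ++ [i], by simp only [List.map_append, List.sum_append,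
            List.map_cons, List.map_nil, List.sum_singleton, hi], by simp⟩
        · rw [add_assoc, pow_add]
          exact mul_le_mul_left hA' _

variable [LinearOrder β]

lemma pow_le_span_sortedProd (h : LayerSpanning e lay b) (m : ℕ) :
    augSpace e ^ m ≤ Submodule.span (ZMod 2) {x | ∃ s : Finset β,
      ∑ i ∈ s, (lay i + 1) = m ∧ sortedProd (fun i => e (b i) - 1) s = x} ⊔
      augSpace e ^ (m + 1) := by
  refine (h.pow_le_span_prod m).trans (sup_le (Submodule.span_le.2 ?_) le_sup_right)
  rintro _ ⟨l, rfl, rfl⟩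
  exact prod_mem_span_sortedProd h.mem_pow h.comm h.sq l

lemma pow_le_span_sortedProd_ge (h : LayerSpanning e lay b) {m M : ℕ} (hM : m ≤ M) :
    augSpace e ^ m ≤ Submodule.span (ZMod 2) {x | ∃ s : Finset β,
      m ≤ ∑ i ∈ s, (lay i + 1) ∧ sortedProd (fun i => e (b i) - 1) s = x} ⊔
      augSpace e ^ M := by
  induction M, hM using Nat.le_induction with
  | base => exact le_sup_right
  | succ M hM ih =>
    refine ih.trans (sup_le le_sup_left ((h.pow_le_span_sortedProd M).trans
      (sup_le_sup_right (Submodule.span_mono ?_) _)))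
    rintro _ ⟨s, hs, rfl⟩
    exact ⟨s, hs ▸ hM, rfl⟩

end LayerSpanning

end LayerBasis

section Nilpotent

/-- A finite nonzero `ZMod 2`-representation of a finite `2`-group has a nonzero fixed vector. -/
lemma exists_fixed_vector {G V : Type*} [Group G] (hG : IsPGroup 2 G)
    [AddCommGroup V] [Module (ZMod 2) V] [Finite V] [Nontrivial V]
    (ρ : G →* Module.End (ZMod 2) V) : ∃ v : V, v ≠ 0 ∧ ∀ g, ρ g v = v := by
  let _ : MulAction G V := MulAction.compHom V ρ
  have h2 : 2 ∣ Nat.card V := by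
    rw [Module.natCard_eq_pow_finrank (K := ZMod 2), Nat.card_zmod]
    exact dvd_pow_self _ (Module.finrank_pos).ne'
  have h0 : (0 : V) ∈ MulAction.fixedPoints G V := fun g => map_zero (ρ g)
  obtain ⟨v, hv, hne⟩ := hG.exists_fixed_point_of_prime_dvd_card_of_fixed_point V h2 h0
  exact ⟨v, hne.symm, fun g => hv g⟩

/-- The augmentation ideal of a finite `2`-group is nilpotent. -/
lemma exists_augSpace_pow_eq_bot {G S : Type*} [Group G] [Ring S] [Algebra (ZMod 2) S]
    [Finite S] (hG : IsPGroup 2 G) (e : G →* S) : ∃ M, augSpace e ^ (M + 1) = ⊥ := by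
  obtain ⟨M, hM⟩ : ∃ M, augSpace e ^ (M + 1) = augSpace e ^ (M + 2) := by
    obtain ⟨M, hM⟩ := WellFoundedGT.monotone_chain_condition
      (⟨fun M => OrderDual.toDual (augSpace e ^ (M + 1)),
        fun _ _ h => augSpace_pow_anti e h⟩ : ℕ →o (Submodule (ZMod 2) S)ᵒᵈ)
    exact ⟨M, hM (M + 1) (by omega)⟩
  refine ⟨M, ?_⟩
  set J := augSpace e ^ (M + 1) with hJ
  let A : Submodule (ZMod 2) S := 
    { carrier := {x | ∀ j ∈ J, j * x = 0}
      add_mem' := fun {x y} hx hy j hj => by rw [mul_add, hx j hj, hy j hj, add_zero]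
      zero_mem' := fun j _ => mul_zero j
      smul_mem' := fun c x hx j hj => by rw [mul_smul_comm, hx j hj, smul_zero] }
  have hA : ∀ g : G, A ≤ A.comap (LinearMap.mulLeft (ZMod 2) (e g)) := fun g x hx j hj => by
    rw [LinearMap.mulLeft_apply, ← mul_assoc]
    exact hx _ (mul_map_mem_augSpace_pow e g hj)
  let ρ : G →* Module.End (ZMod 2) (S ⧸ A) :=
    { toFun := fun g => A.mapQ A (LinearMap.mulLeft (ZMod 2) (e g)) (hA g)
      map_one' := by ext; simp
      map_mul' := fun g h => by ext; simp }
  by_contra hne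
  have : Nontrivial (S ⧸ A) := by
    rw [Submodule.Quotient.nontrivial_iff]
    intro htop
    refine hne ((Submodule.eq_bot_iff _).2 fun j hj => ?_)
    have : (1 : S) ∈ A := htop ▸ Submodule.mem_top
    simpa using this j hj
  have : Finite (S ⧸ A) := Finite.of_surjective _ A.mkQ_surjective
  obtain ⟨v, hv, hfix⟩ := exists_fixed_vector hG ρ
  obtain ⟨x, rfl⟩ := A.mkQ_surjective v
  refine hv ((Submodule.Quotient.mk_eq_zero A).2 fun j hj => ?_)
  have hx : ∀ g, (e g - 1) * x ∈ A := fun g => by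
    have := hfix g
    rw [← sub_eq_zero] at this
    rw [← Submodule.Quotient.mk_eq_zero, sub_mul, one_mul]
    exact this
  rw [hM, pow_succ] at hj
  induction hj using Submodule.mul_induction_on' with
  | mem_mul_mem j hj i hi =>
    rw [mul_assoc]
    induction hi using Submodule.span_induction with
    | mem i hi => 
      obtain ⟨g, rfl⟩ := hi
      exact hx g j hj
    | zero => simp
    | add i i' _ _ h h' => rw [add_mul, mul_add, h, h', add_zero]
    | smul c i _ h => rw [smul_mul_assoc, mul_smul_comm, h, smul_zero]
  | add j _ j' _ h h' => rw [add_mul, h, h', add_zero]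

end Nilpotent

section Jennings

variable {Γ : Type*} [Group Γ]

local notation "δ" => MonoidAlgebra.of (ZMod 2) Γ

/-- The homomorphism of group algebras induced by a quotient map. -/
noncomputable abbrev quotAlgHom (N : Subgroup Γ) [N.Normal] :
    MonoidAlgebra (ZMod 2) Γ →ₐ[ZMod 2] MonoidAlgebra (ZMod 2) (Γ ⧸ N) :=
  MonoidAlgebra.mapDomainAlgHom (ZMod 2) (ZMod 2) (QuotientGroup.mk' N)

lemma quotAlgHom_of (N : Subgroup Γ) [N.Normal] (g : Γ) :
    quotAlgHom N (MonoidAlgebra.of (ZMod 2) Γ g) =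
      MonoidAlgebra.of (ZMod 2) (Γ ⧸ N) (QuotientGroup.mk' N g) := by
  simp [quotAlgHom]

lemma quotAlgHom_surjective (N : Subgroup Γ) [N.Normal] :
    Function.Surjective (quotAlgHom N) := by
  intro x
  induction x using MonoidAlgebra.induction_on with
  | of g =>
    obtain ⟨g, rfl⟩ := QuotientGroup.mk'_surjective N g
    exact ⟨_, quotAlgHom_of N g⟩
  | add x y hx hy =>
    obtain ⟨x, rfl⟩ := hx
    obtain ⟨y, rfl⟩ := hy
    exact ⟨x + y, map_add _ _ _⟩
  | smul c x hx =>
    obtain ⟨x, rfl⟩ := hx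
    exact ⟨c • x, map_smul _ _ _⟩

/-- The kernel of the quotient map of group algebras by `D n` lies in `I ^ (n + 1)`. -/
lemma ker_quotAlgHom_le (n : ℕ) :
    LinearMap.ker (quotAlgHom (dimSubgroup δ n)).toLinearMap ≤ augSpace δ ^ (n + 1) := by
  -- the linear map sending a coset to the class of a representative
  set N := dimSubgroup δ n
  set J := augSpace δ ^ (n + 1)
  let s : MonoidAlgebra (ZMod 2) (Γ ⧸ N) →ₗ[ZMod 2] MonoidAlgebra (ZMod 2) Γ ⧸ J :=
    (MonoidAlgebra.basis (Γ ⧸ N) (ZMod 2)).constr (ZMod 2) fun q => J.mkQ (δ q.out)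
  have hs : ∀ x, s (quotAlgHom N x) = J.mkQ x := by
    intro x
    induction x using MonoidAlgebra.induction_on with
    | of g =>
      have h1 : s (MonoidAlgebra.basis (Γ ⧸ N) (ZMod 2) (QuotientGroup.mk' N g)) =
          J.mkQ (δ (QuotientGroup.mk' N g).out) := Module.Basis.constr_basis _ _ _ _
      rw [quotAlgHom_of, MonoidAlgebra.of_apply, ← MonoidAlgebra.basis_apply, h1]
      refine (Submodule.Quotient.eq J).2 ?_
      have h2 : g⁻¹ * (QuotientGroup.mk' N g).out ∈ N := by
        rw [← QuotientGroup.eq]; simp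
      have h3 : δ (QuotientGroup.mk' N g).out - δ g =
          δ g * (δ (g⁻¹ * (QuotientGroup.mk' N g).out) - 1) := by
        rw [mul_sub, ← map_mul]; simp
      rw [h3]
      exact map_mul_mem_augSpace_pow _ g h2
    | add x y hx hy => rw [map_add, map_add, map_add, hx, hy]
    | smul c x hx => rw [map_smul, map_smul, map_smul, hx]
  intro x hx
  have h1 : quotAlgHom N x = 0 := hx
  have h2 := hs x
  rw [h1, map_zero] at h2
  exact (Submodule.Quotient.mk_eq_zero J).1 h2.symm

lemma map_augSpace (N : Subgroup Γ) [N.Normal] :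
    (augSpace δ).map (quotAlgHom N).toLinearMap =
      augSpace (MonoidAlgebra.of (ZMod 2) (Γ ⧸ N)) := by
  rw [augSpace, augSpace, Submodule.map_span, ← Set.range_comp]
  congr 1
  ext x
  constructor
  · rintro ⟨g, rfl⟩
    exact ⟨QuotientGroup.mk' N g, by
      rw [Function.comp_apply, AlgHom.toLinearMap_apply, map_sub, quotAlgHom_of, map_one]⟩
  · rintro ⟨g, rfl⟩
    obtain ⟨g, rfl⟩ := QuotientGroup.mk'_surjective N g
    exact ⟨g, by
      rw [Function.comp_apply, AlgHom.toLinearMap_apply, map_sub, quotAlgHom_of, map_one]⟩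

variable {β : Type*} [LinearOrder β] {lay : β → ℕ} {b : β → Γ}

/-- Jennings' theorem, in numerical form. -/
theorem finrank_quotient_eq_card (h : LayerSpanning δ lay b) {n : ℕ} (B : Finset β)
    (hB : ∀ i, i ∈ B ↔ lay i < n) (hcard : (dimSubgroup δ n).index = 2 ^ B.card)
    {m : ℕ} (hm : m ≤ n) :
    Module.finrank (ZMod 2) (MonoidAlgebra (ZMod 2) Γ ⧸ augSpace δ ^ (m + 1)) =
      (B.powerset.filter fun s => ∑ i ∈ s, (lay i + 1) < m + 1).card := by
  set N := dimSubgroup δ n with hN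
  set f := quotAlgHom N with hf
  set y : Finset β → MonoidAlgebra (ZMod 2) (Γ ⧸ N) :=
    fun s => f (sortedProd (fun i => δ (b i) - 1) s) with hy
  have hcardN : Nat.card (Γ ⧸ N) = 2 ^ B.card := hcard
  have : Finite (Γ ⧸ N) := Nat.finite_of_card_ne_zero (by rw [hcardN]; positivity)
  have hp : IsPGroup 2 (Γ ⧸ N) := IsPGroup.of_card hcardN
  have : Fintype (Γ ⧸ N) := Fintype.ofFinite _
  have : Module.Finite (ZMod 2) (MonoidAlgebra (ZMod 2) (Γ ⧸ N)) :=
    Module.Finite.of_basis (MonoidAlgebra.basis (Γ ⧸ N) (ZMod 2))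
  have : Finite (MonoidAlgebra (ZMod 2) (Γ ⧸ N)) := Module.finite_of_finite (ZMod 2)
  have hfr : Module.finrank (ZMod 2) (MonoidAlgebra (ZMod 2) (Γ ⧸ N)) = 2 ^ B.card := by
    rw [Module.finrank_eq_card_basis (MonoidAlgebra.basis (Γ ⧸ N) (ZMod 2)),
      ← Nat.card_eq_fintype_card, hcardN]
  obtain ⟨M, hM⟩ := exists_augSpace_pow_eq_bot hp (MonoidAlgebra.of (ZMod 2) (Γ ⧸ N))
  have hpow : ∀ k, (augSpace δ ^ k).map f.toLinearMap =
      augSpace (MonoidAlgebra.of (ZMod 2) (Γ ⧸ N)) ^ k := fun k => by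
    rw [← map_augSpace, Submodule.map_pow]
  -- products involving deep layers vanish
  have hvan : ∀ s, ¬ s ⊆ B → y s = 0 := by
    intro s hs
    obtain ⟨i, his, hi⟩ := Finset.not_subset.1 hs
    have h0 : f (δ (b i) - 1) = 0 := by
      have : b i ∈ N := dimSubgroup_anti δ (not_lt.1 fun h' => hi ((hB i).2 h')) (h.mem i)
      rw [map_sub, hf, quotAlgHom_of, map_one, QuotientGroup.mk'_apply,
        (QuotientGroup.eq_one_iff _).2 this, map_one, sub_self]
    simp only [hy, sortedProd, map_list_prod, List.map_map]
    exact List.prod_eq_zero (List.mem_map.2 ⟨i, (Finset.mem_sort _).2 his, h0⟩)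
  have hspan : ∀ k, augSpace (MonoidAlgebra.of (ZMod 2) (Γ ⧸ N)) ^ k ≤
      Submodule.span (ZMod 2) (y '' {s | s ∈ B.powerset ∧ k ≤ ∑ i ∈ s, (lay i + 1)}) := by
    intro k
    rw [← hpow]
    refine (Submodule.map_mono (h.pow_le_span_sortedProd_ge (le_max_left k (M + 1)))).trans ?_
    rw [Submodule.map_sup, hpow, Submodule.map_span]
    have h0 : augSpace (MonoidAlgebra.of (ZMod 2) (Γ ⧸ N)) ^ max k (M + 1) = ⊥ := by
      rw [← le_bot_iff, ← hM]
      obtain ⟨c, hc⟩ := Nat.exists_eq_add_of_le (le_max_right k (M + 1))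
      rw [hc, show M + 1 + c = M + c + 1 by ring]
      exact augSpace_pow_anti _ (by omega)
    rw [h0, sup_bot_eq, Submodule.span_le]
    rintro _ ⟨_, ⟨s, hs, rfl⟩, rfl⟩
    by_cases hsB : s ⊆ B
    · exact Submodule.subset_span ⟨s, ⟨Finset.mem_powerset.2 hsB, hs⟩, rfl⟩
    · have := hvan s hsB
      simp only [hy] at this
      rw [AlgHom.toLinearMap_apply, this]
      exact zero_mem _
  -- linear independence, by counting
  have htop : (⊤ : Submodule (ZMod 2) (MonoidAlgebra (ZMod 2) (Γ ⧸ N))) ≤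
      Submodule.span (ZMod 2) (Set.range fun s : B.powerset => y s) := by
    have hr : Set.range (fun s : B.powerset => y s) = y '' {s | s ∈ B.powerset} := by
      ext; simp
    have hk : ∀ k, augSpace (MonoidAlgebra.of (ZMod 2) (Γ ⧸ N)) ^ k ≤
        Submodule.span (ZMod 2) (Set.range fun s : B.powerset => y s) := fun k => by
      rw [hr]
      exact (hspan k).trans (Submodule.span_mono (Set.image_mono fun s hs => hs.1))
    rintro x -
    induction x using MonoidAlgebra.induction_on with
    | of g =>
      rw [← sub_add_cancel (MonoidAlgebra.of (ZMod 2) (Γ ⧸ N) g) 1]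
      exact add_mem (hk 1 (sub_one_mem_augSpace_pow_one _ g)) (hk 0 (by rw [pow_zero]; exact Submodule.one_le.1 le_rfl))
    | add x y hx hy => exact add_mem hx hy
    | smul c x hx => exact Submodule.smul_mem _ c hx
  have hli : LinearIndependent (ZMod 2) (fun s : B.powerset => y s) :=
    linearIndependent_of_top_le_span_of_card_eq_finrank htop (by simp [hfr])
  set J := augSpace (MonoidAlgebra.of (ZMod 2) (Γ ⧸ N)) ^ (m + 1) with hJ
  set F := B.powerset.filter fun s => m + 1 ≤ ∑ i ∈ s, (lay i + 1) with hF
  have hJF : J = Submodule.span (ZMod 2) (Set.range fun s : F => y s) := by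
    have hr : Set.range (fun s : F => y s) =
        y '' {s | s ∈ B.powerset ∧ m + 1 ≤ ∑ i ∈ s, (lay i + 1)} := by
      ext; simp [hF, and_assoc]
    refine le_antisymm (by rw [hr]; exact hspan _) (Submodule.span_le.2 ?_)
    rintro _ ⟨⟨s, hs⟩, rfl⟩
    obtain ⟨c, hc⟩ := Nat.exists_eq_add_of_le (Finset.mem_filter.1 hs).2
    have h1 := sortedProd_mem_pow h.mem_pow s
    rw [hc, show m + 1 + c = m + c + 1 by ring] at h1
    rw [hJ, ← hpow]
    exact Submodule.mem_map_of_mem (augSpace_pow_anti _ (by omega) h1)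
  have hFr : Module.finrank (ZMod 2) J = F.card := by
    rw [hJF, finrank_span_eq_card, Fintype.card_coe]
    exact hli.comp (fun s : F => (⟨s, (Finset.mem_filter.1 s.2).1⟩ : B.powerset))
      fun s t hst => Subtype.ext (congrArg (fun u : B.powerset => (u : Finset β)) hst)
  have hker : LinearMap.ker (J.mkQ ∘ₗ f.toLinearMap) = augSpace δ ^ (m + 1) := by
    rw [LinearMap.ker_comp, Submodule.ker_mkQ, hJ, ← hpow, Submodule.comap_map_eq]
    exact sup_eq_left.2 ((ker_quotAlgHom_le n).trans (augSpace_pow_anti _ hm))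
  have hsurj : Function.Surjective (J.mkQ ∘ₗ f.toLinearMap) :=
    J.mkQ_surjective.comp (quotAlgHom_surjective N)
  have e1 := (LinearMap.quotKerEquivOfSurjective _ hsurj).finrank_eq
  rw [hker] at e1
  have e2 := Submodule.finrank_quotient_add_finrank J
  have e3 := Finset.card_filter_add_card_filter_not (s := B.powerset)
    (fun s => ∑ i ∈ s, (lay i + 1) < m + 1)
  simp only [not_lt, Finset.card_powerset] at e3
  rw [hFr, hfr, hF] at e2
  rw [e1]
  omega

end Jennings

section LayerRank

variable {Γ R : Type*} [Group Γ] [Ring R] [Algebra (ZMod 2) R] (e : Γ →* R)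

/-- The dimension of the `n`-th layer `D n / D (n + 1)` of the filtration by dimension
subgroups. -/
noncomputable def layerRank (n : ℕ) : ℕ :=
  Module.finrank (ZMod 2) (layerSpace e (dimSubgroup e n) le_rfl)

variable [∀ n, Module.Finite (ZMod 2) (R ⧸ augSpace e ^ (n + 1))]

lemma relIndex_dimSubgroup (n : ℕ) :
    (dimSubgroup e (n + 1)).relIndex (dimSubgroup e n) = 2 ^ layerRank e n :=
  relIndex_eq_two_pow e _ le_rfl

lemma index_dimSubgroup (n : ℕ) :
    (dimSubgroup e n).index = 2 ^ ∑ i ∈ Finset.range n, layerRank e i := by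
  induction n with
  | zero => simp [dimSubgroup_zero]
  | succ n ih =>
    rw [← Subgroup.relIndex_mul_index (dimSubgroup_anti e n.le_succ), ih, relIndex_dimSubgroup,
      Finset.sum_range_succ, pow_add, mul_comm]

lemma layerRank_le (n : ℕ) :
    layerRank e n ≤ Module.finrank (ZMod 2) (R ⧸ augSpace e ^ (n + 2)) :=
  Submodule.finrank_le _

lemma exists_layerSpanning : ∃ b : (Σₗ n : ℕ, Fin (layerRank e n)) → Γ,
    LayerSpanning e (fun i => (ofLex i).1) b := by
  choose b hb hspan using fun n => exists_layer_basis e (dimSubgroup e n) le_rfl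
  refine ⟨fun i => b (ofLex i).1 (ofLex i).2, fun i => hb _ _, fun n g hg => ?_⟩
  have hle : Submodule.span (ZMod 2) (Set.range fun j => e (b n j) - 1) ≤
      Submodule.span (ZMod 2) {x | ∃ i : Σₗ n : ℕ, Fin (layerRank e n),
        (ofLex i).1 + 1 = n + 1 ∧ e (b (ofLex i).1 (ofLex i).2) - 1 = x} := Submodule.span_mono ?_
  · exact sup_le_sup_right hle _ (hspan n g hg)
  rintro _ ⟨j, rfl⟩
  exact ⟨toLex ⟨n, j⟩, rfl, rfl⟩

end LayerRank

section Counting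

/-- The subset-sum generating function. -/
lemma coeff_prod_one_add_X_pow {β : Type*} (B : Finset β) (w : β → ℕ) (j : ℕ) :
    PowerSeries.coeff j (∏ i ∈ B, (1 + PowerSeries.X ^ w i : PowerSeries ℝ)) =
      ((B.powerset.filter fun s => ∑ i ∈ s, w i = j).card : ℝ) := by
  simp only [Finset.prod_one_add, Finset.prod_pow_eq_pow_sum, map_sum, PowerSeries.coeff_X_pow,
    Finset.sum_boole, eq_comm]

lemma sum_coeff_prod_one_add_X_pow {β : Type*} (B : Finset β) (w : β → ℕ) (m : ℕ) :
    ∑ j ∈ Finset.range m,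
      PowerSeries.coeff j (∏ i ∈ B, (1 + PowerSeries.X ^ w i : PowerSeries ℝ)) =
      ((B.powerset.filter fun s => ∑ i ∈ s, w i < m).card : ℝ) := by
  simp only [coeff_prod_one_add_X_pow]
  rw [← Nat.cast_sum, Finset.card_eq_sum_card_fiberwise (f := fun s => ∑ i ∈ s, w i)
    (t := Finset.range m) (fun s hs => by simpa using (Finset.mem_filter.1 hs).2)]
  congr 1
  refine Finset.sum_congr rfl fun j hj => congrArg _ ?_
  ext s
  simp only [Finset.mem_filter, Finset.mem_range] at *
  constructor
  · rintro ⟨h, rfl⟩; exact ⟨⟨h, hj⟩, rfl⟩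
  · rintro ⟨⟨h, -⟩, h'⟩; exact ⟨h, h'⟩

variable {Γ : Type*} [Group Γ]

/-- Jennings' formula for the Hilbert function of the augmentation filtration. -/
theorem finrank_quotient_eq_sum_coeff
    [∀ n, Module.Finite (ZMod 2)
      (MonoidAlgebra (ZMod 2) Γ ⧸ augSpace (MonoidAlgebra.of (ZMod 2) Γ) ^ (n + 1))]
    {m n : ℕ} (hm : m ≤ n) :
    (Module.finrank (ZMod 2)
      (MonoidAlgebra (ZMod 2) Γ ⧸ augSpace (MonoidAlgebra.of (ZMod 2) Γ) ^ (m + 1)) : ℝ) =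
    ∑ j ∈ Finset.range (m + 1), PowerSeries.coeff j (∏ i ∈ Finset.range n,
      (1 + PowerSeries.X ^ (i + 1) : PowerSeries ℝ) ^
        layerRank (MonoidAlgebra.of (ZMod 2) Γ) i) := by
  set e := MonoidAlgebra.of (ZMod 2) Γ
  obtain ⟨b, hb⟩ := exists_layerSpanning e
  set B : Finset (Σₗ n : ℕ, Fin (layerRank e n)) :=
    ((Finset.range n).sigma fun _ => Finset.univ).map toLex.toEmbedding with hBdef
  have hB : ∀ i, i ∈ B ↔ (ofLex i).1 < n := by
    intro i
    simp only [hBdef, Finset.mem_map, Finset.mem_sigma, Finset.mem_range, Finset.mem_univ, and_true]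
    constructor
    · rintro ⟨a, h, rfl⟩; exact h
    · intro h; exact ⟨ofLex i, h, rfl⟩
  have hcard : B.card = ∑ i ∈ Finset.range n, layerRank e i := by
    simp [hBdef]
  have h1 := finrank_quotient_eq_card hb B hB (by rw [index_dimSubgroup, hcard]) hm
  rw [h1, ← sum_coeff_prod_one_add_X_pow]
  refine Finset.sum_congr rfl fun j _ => congrArg _ ?_
  rw [hBdef, Finset.prod_map, Finset.prod_sigma]
  simp

end Counting

section LogDerivative

open PowerSeries

/-- The series `k X ^ k / (1 + X ^ k)`. -/
noncomputable def logSeries (k : ℕ) : PowerSeries ℝ :=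
  .mk fun m => if m ≠ 0 ∧ k ∣ m then k * (-1) ^ (m / k + 1) else 0

lemma one_add_X_pow_mul_logSeries {k : ℕ} (hk : k ≠ 0) :
    (1 + X ^ k) * logSeries k = (k : PowerSeries ℝ) * X ^ k := by
  ext m
  have hc : (k : PowerSeries ℝ) * X ^ k = C (k : ℝ) * X ^ k := by simp
  rw [hc, coeff_C_mul, add_mul, one_mul, map_add, coeff_X_pow_mul', coeff_X_pow]
  simp only [logSeries, coeff_mk]
  rcases lt_trichotomy m k with h | rfl | h
  · have : ¬ (m ≠ 0 ∧ k ∣ m) := fun ⟨h0, hd⟩ => by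
      have := Nat.le_of_dvd (Nat.pos_of_ne_zero h0) hd; omega
    rw [if_neg this, if_neg (by omega), if_neg (by omega)]; simp
  · simp [hk, Nat.div_self (Nat.pos_of_ne_zero hk)]
  · obtain ⟨c, rfl⟩ := Nat.exists_eq_add_of_lt h
    rw [if_pos (by omega : k ≤ k + c + 1), if_neg (by omega : ¬ k + c + 1 = k),
      show k + c + 1 - k = c + 1 by omega]
    by_cases hd : k ∣ c + 1
    · have hd' : k ∣ k + c + 1 := by rw [add_assoc]; exact (Nat.dvd_add_right dvd_rfl).2 hd
      rw [if_pos ⟨by omega, hd'⟩, if_pos ⟨by omega, hd⟩, add_assoc,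
        Nat.add_div_left _ (Nat.pos_of_ne_zero hk)]
      ring
    · have hd' : ¬ k ∣ k + c + 1 := by
        rw [add_assoc]; exact fun h => hd ((Nat.dvd_add_right dvd_rfl).1 h)
      rw [if_neg (fun h => hd' h.2), if_neg (fun h => hd h.2)]; simp

/-- `X f' = f g`. -/
def IsLogDeriv (f g : PowerSeries ℝ) : Prop := X * derivative ℝ f = f * g

lemma IsLogDeriv.mul {f g f' g' : PowerSeries ℝ} (h : IsLogDeriv f g) (h' : IsLogDeriv f' g') :
    IsLogDeriv (f * f') (g + g') := by
  unfold IsLogDeriv at *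
  rw [Derivation.leibniz, smul_eq_mul, smul_eq_mul]
  linear_combination f' * h + f * h'

lemma isLogDeriv_one : IsLogDeriv 1 0 := by simp [IsLogDeriv]

lemma IsLogDeriv.pow {f g : PowerSeries ℝ} (h : IsLogDeriv f g) (n : ℕ) :
    IsLogDeriv (f ^ n) (n • g) := by
  induction n with
  | zero => simpa using isLogDeriv_one
  | succ n ih => rw [pow_succ, succ_nsmul]; exact ih.mul h

lemma IsLogDeriv.prod {f g : ℕ → PowerSeries ℝ} (s : Finset ℕ)
    (h : ∀ i ∈ s, IsLogDeriv (f i) (g i)) : IsLogDeriv (∏ i ∈ s, f i) (∑ i ∈ s, g i) := by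
  induction s using Finset.cons_induction with
  | empty => exact isLogDeriv_one
  | cons a s ha ih =>
    rw [Finset.prod_cons, Finset.sum_cons]
    exact (h a (Finset.mem_cons_self a s)).mul
      (ih fun i hi => h i (Finset.mem_cons_of_mem hi))

lemma isLogDeriv_one_add_X_pow {k : ℕ} (hk : k ≠ 0) :
    IsLogDeriv (1 + X ^ k) (logSeries k) := by
  unfold IsLogDeriv
  rw [one_add_X_pow_mul_logSeries hk, map_add, Derivation.leibniz_pow]
  obtain ⟨k, rfl⟩ := Nat.exists_eq_succ_of_ne_zero hk
  simp [pow_succ]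
  ring

/-- The series `∑ q ^ j X ^ j`. -/
noncomputable def geomSeries (q : ℝ) : PowerSeries ℝ := .mk fun j => q ^ j

lemma geomSeries_eq (q : ℝ) : geomSeries q = 1 + C q * X * geomSeries q := by
  ext m
  rw [map_add, mul_assoc, coeff_C_mul]
  cases m with
  | zero => simp [geomSeries]
  | succ m =>
    rw [coeff_succ_X_mul]; simp [geomSeries, coeff_one, pow_succ, mul_comm]

lemma isLogDeriv_geomSeries (q : ℝ) : IsLogDeriv (geomSeries q) (C q * X * geomSeries q) := by
  unfold IsLogDeriv
  have h := geomSeries_eq q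
  have hd := congrArg (derivative ℝ) h
  simp only [map_add, Derivation.leibniz, smul_eq_mul, derivative_C, derivative_X] at hd
  have h1 : (derivative ℝ) (1 : PowerSeries ℝ) = 0 := by simp
  rw [h1] at hd
  have h0 : (1 - C q * X) * geomSeries q = 1 := by linear_combination h
  -- multiply by the unit `1 - q X`
  have h2 : (1 - C q * X) * (X * derivative ℝ (geomSeries q)) = C q * X * geomSeries q := by
    linear_combination X * hd
  calc X * derivative ℝ (geomSeries q)
      = geomSeries q * ((1 - C q * X) * (X * derivative ℝ (geomSeries q))) := by
        linear_combination -(X * derivative ℝ (geomSeries q)) * h0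
    _ = _ := by rw [h2]

/-- Logarithmic derivatives of series that agree up to degree `n` agree up to degree `n`. -/
lemma IsLogDeriv.coeff_eq {f g f' g' : PowerSeries ℝ} (h : IsLogDeriv f g)
    (h' : IsLogDeriv f' g') (h0 : coeff 0 f ≠ 0) {n : ℕ} (hf : ∀ j ≤ n, coeff j f = coeff j f') :
    ∀ j ≤ n, coeff j g = coeff j g' := by
  have h1 : X ^ (n + 1) ∣ f - f' := X_pow_dvd_iff.2 fun m hm => by
    rw [map_sub, hf m (by omega), sub_self]
  have h2 : X ^ (n + 1) ∣ X * derivative ℝ f - X * derivative ℝ f' :=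
    X_pow_dvd_iff.2 fun m hm => by
      rw [← mul_sub, ← map_sub]
      cases m with
      | zero => simp
      | succ m =>
        rw [coeff_succ_X_mul, coeff_derivative, map_sub, hf _ (by omega), sub_self, zero_mul]
  have h3 : X ^ (n + 1) ∣ f * (g - g') := by
    have : f * (g - g') = (X * derivative ℝ f - X * derivative ℝ f') - (f - f') * g' := by
      unfold IsLogDeriv at h h'
      linear_combination -h + h'
    rw [this]
    exact dvd_sub h2 (h1.mul_right _)
  have h4 := X_prime.pow_dvd_of_dvd_mul_left (n + 1)
    (fun hd => h0 (by rw [coeff_zero_eq_constantCoeff]; exact X_dvd_iff.1 hd)) h3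
  intro j hj
  have := X_pow_dvd_iff.1 h4 j (by omega)
  rwa [map_sub, sub_eq_zero] at this

/-- Comparison of an infinite product expansion with `(1 + X) / (1 - q X)`. -/
lemma sum_mul_coeff_logSeries (L : ℕ → ℕ) (q : ℝ) {n : ℕ}
    (h : ∀ j ≤ n, coeff j (∏ i ∈ Finset.range n, (1 + X ^ (i + 1) : PowerSeries ℝ) ^ L i) =
      coeff j ((1 + X) * geomSeries q)) {m : ℕ} (hm : m + 1 ≤ n) :
    ∑ i ∈ Finset.range n, (L i : ℝ) * coeff (m + 1) (logSeries (i + 1)) =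
      (-1) ^ m + q ^ (m + 1) := by
  have h1 : IsLogDeriv (∏ i ∈ Finset.range n, (1 + X ^ (i + 1) : PowerSeries ℝ) ^ L i)
      (∑ i ∈ Finset.range n, L i • logSeries (i + 1)) :=
    IsLogDeriv.prod _ fun i _ => (isLogDeriv_one_add_X_pow i.succ_ne_zero).pow _
  have h2 : IsLogDeriv ((1 + X) * geomSeries q) (logSeries 1 + C q * X * geomSeries q) := by
    refine IsLogDeriv.mul ?_ (isLogDeriv_geomSeries q)
    simpa using isLogDeriv_one_add_X_pow one_ne_zero
  have h3 := h1.coeff_eq h2 (by rw [h 0 (by omega)]; simp [geomSeries]) h (m + 1) hm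
  rw [map_sum] at h3
  have h4 : ∀ i, coeff (m + 1) (L i • logSeries (i + 1)) =
      (L i : ℝ) * coeff (m + 1) (logSeries (i + 1)) := fun i => by
    rw [map_nsmul, nsmul_eq_mul]
  simp only [h4] at h3
  rw [h3, map_add, mul_assoc, coeff_C_mul, coeff_succ_X_mul]
  simp [logSeries, geomSeries, pow_succ, mul_comm]

/-- The number of factors of degree `m` is asymptotic to `q ^ m / m`. -/
lemma abs_mul_sub_pow_le (L : ℕ → ℕ) {q : ℝ} (hq : 1 ≤ q) {n : ℕ}
    (h : ∀ j ≤ n + 1, coeff j (∏ i ∈ Finset.range (n + 1),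
      (1 + X ^ (i + 1) : PowerSeries ℝ) ^ L i) = coeff j ((1 + X) * geomSeries q))
    (hL : ∀ i, (L i : ℝ) ≤ 3 * q ^ (i + 1)) :
    |((n : ℝ) + 1) * L n - q ^ (n + 1)| ≤ 1 + 3 * ((n : ℝ) + 1) ^ 2 * q ^ ((n + 1) / 2) := by
  have h1 := sum_mul_coeff_logSeries L q h le_rfl
  rw [Finset.sum_range_succ] at h1
  have h2 : coeff (n + 1) (logSeries (n + 1)) = (n : ℝ) + 1 := by simp [logSeries]
  have h3 : |∑ i ∈ Finset.range n, (L i : ℝ) * coeff (n + 1) (logSeries (i + 1))| ≤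
      3 * ((n : ℝ) + 1) ^ 2 * q ^ ((n + 1) / 2) := by
    refine (Finset.abs_sum_le_sum_abs _ _).trans ?_
    have hb : ∀ i ∈ Finset.range n, |(L i : ℝ) * coeff (n + 1) (logSeries (i + 1))| ≤
        3 * ((n : ℝ) + 1) * q ^ ((n + 1) / 2) := by
      intro i hi
      have hi := Finset.mem_range.1 hi
      simp only [logSeries, coeff_mk]
      split_ifs with hd
      · have hi2 : i + 1 ≤ (n + 1) / 2 := by
          obtain ⟨c, hc⟩ := hd.2
          have : 2 ≤ c := by
            by_contra hlt
            interval_cases c <;> omega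
          rw [Nat.le_div_iff_mul_le (by norm_num), hc]
          exact Nat.mul_le_mul_left _ this
        rw [abs_mul, abs_mul, abs_pow, abs_neg, abs_one, one_pow, mul_one, Nat.abs_cast,
          Nat.abs_cast]
        have e1 : (L i : ℝ) ≤ 3 * q ^ ((n + 1) / 2) :=
          (hL i).trans (by gcongr)
        have e2 : ((i + 1 : ℕ) : ℝ) ≤ n + 1 := by exact_mod_cast (by omega : i + 1 ≤ n + 1)
        calc (L i : ℝ) * ((i + 1 : ℕ) : ℝ) ≤ (3 * q ^ ((n + 1) / 2)) * (n + 1) := by gcongr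
          _ = _ := by ring
      · rw [mul_zero, abs_zero]; positivity
    refine (Finset.sum_le_sum hb).trans ?_
    rw [Finset.sum_const, Finset.card_range, nsmul_eq_mul]
    have : (n : ℝ) ≤ n + 1 := by linarith
    calc (n : ℝ) * (3 * ((n : ℝ) + 1) * q ^ ((n + 1) / 2))
        ≤ (n + 1 : ℝ) * (3 * ((n : ℝ) + 1) * q ^ ((n + 1) / 2)) := by gcongr
      _ = _ := by ring
  rw [h2] at h1
  have h4 : ((n : ℝ) + 1) * L n - q ^ (n + 1) = (-1) ^ n -
      ∑ i ∈ Finset.range n, (L i : ℝ) * coeff (n + 1) (logSeries (i + 1)) := by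
    linear_combination h1
  rw [h4]
  refine (abs_sub _ _).trans (add_le_add ?_ h3)
  rw [abs_pow, abs_neg, abs_one, one_pow]

end LogDerivative

section Generators

variable {d : ℕ}

/-- The `i`-th generator. -/
def coxGen (i : Fin d) : UnivCoxeter d :=
  (PresentedGroup.of i : PresentedGroup {r : FreeGroup (Fin d) | ∃ i : Fin d, r = FreeGroup.of i ^ 2})

lemma coxGen_mul_self (i : Fin d) : coxGen i * coxGen i = 1 := by
  have : PresentedGroup.mk {r : FreeGroup (Fin d) | ∃ i : Fin d, r = FreeGroup.of i ^ 2}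
      (FreeGroup.of i ^ 2) = 1 :=
    PresentedGroup.mk_eq_one_iff.2 (Subgroup.subset_normalClosure ⟨i, rfl⟩)
  rw [pow_two, map_mul] at this
  exact this

lemma UnivCoxeter.induction {p : UnivCoxeter d → Prop} (one : p 1)
    (mul : ∀ g h, p g → p h → p (g * h)) (gen : ∀ i, p (coxGen i)) (g : UnivCoxeter d) : p g := by
  obtain ⟨z, rfl⟩ := PresentedGroup.mk_surjective _ g
  induction z using FreeGroup.induction_on with
  | C1 => exact one
  | of i => exact gen i
  | inv_of i _ =>
    have : (coxGen i)⁻¹ = coxGen i := inv_eq_of_mul_eq_one_right (coxGen_mul_self i)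
    have h := gen i
    rw [← this] at h
    exact h
  | mul x y hx hy =>
    exact mul _ _ hx hy

/-- The universal property of the universal Coxeter group. -/
def UnivCoxeter.lift {G : Type*} [Group G] (f : Fin d → G) (hf : ∀ i, f i * f i = 1) :
    UnivCoxeter d →* G :=
  PresentedGroup.toGroup (f := f) (rels := {r : FreeGroup (Fin d) | ∃ i : Fin d,
    r = FreeGroup.of i ^ 2}) (by rintro _ ⟨i, rfl⟩; simp [pow_two, hf])

lemma UnivCoxeter.lift_coxGen {G : Type*} [Group G] (f : Fin d → G) (hf : ∀ i, f i * f i = 1)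
    (i : Fin d) : UnivCoxeter.lift f hf (coxGen i) = f i :=
  PresentedGroup.toGroup.of _

lemma closure_range_coxGen : Subgroup.closure (Set.range (coxGen (d := d))) = ⊤ := by
  refine (Subgroup.eq_top_iff' _).2 fun g => ?_
  induction g using UnivCoxeter.induction with
  | one => exact one_mem _
  | mul g h hg hh => exact mul_mem hg hh
  | gen i => exact Subgroup.subset_closure ⟨i, rfl⟩

end Generators

section Words

variable {d : ℕ}

/-- The reduced words of length `n + 1` that start with `i`. -/
def wordsFrom : ℕ → Fin d → Finset (List (Fin d))
  | 0, i => {[i]}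
  | n + 1, i => (((Finset.univ.erase i).biUnion (wordsFrom n)).map
      ⟨List.cons i, List.cons_injective⟩)

lemma mem_wordsFrom {n : ℕ} {i : Fin d} {l : List (Fin d)} :
    l ∈ wordsFrom n i ↔ l.IsChain (· ≠ ·) ∧ l.length = n + 1 ∧ l.head? = some i := by
  induction n generalizing i l with
  | zero =>
    rw [wordsFrom, Finset.mem_singleton, zero_add]
    constructor
    · rintro rfl; simp
    · rintro ⟨-, h, h'⟩
      obtain ⟨a, rfl⟩ := List.length_eq_one_iff.1 h
      simpa using h'
  | succ n ih =>
    simp only [wordsFrom, Finset.mem_map, Finset.mem_biUnion, Finset.mem_erase, Finset.mem_univ,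
      and_true, Function.Embedding.coeFn_mk, ih]
    constructor
    · rintro ⟨_, ⟨j, hj, hc, hl, hh⟩, rfl⟩
      refine ⟨List.isChain_cons.2 ⟨fun y hy => ?_, hc⟩, by simp [hl], by simp⟩
      rw [hh] at hy
      obtain rfl : j = y := by simpa using hy
      exact hj.symm
    · rintro ⟨hc, hl, hh⟩
      cases l with
      | nil => simp at hh
      | cons a l =>
        obtain rfl : a = i := by simpa using hh
        cases l with
        | nil => simp at hl
        | cons b l =>
          rw [List.isChain_cons_cons] at hc
          exact ⟨b :: l, ⟨b, hc.1.symm, hc.2, by simpa using hl, rfl⟩, rfl⟩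

lemma disjoint_wordsFrom (n : ℕ) {i j : Fin d} (h : i ≠ j) :
    Disjoint (wordsFrom n i) (wordsFrom n j) :=
  Finset.disjoint_left.2 fun _ h1 h2 => h (Option.some_injective _
    ((mem_wordsFrom.1 h1).2.2.symm.trans (mem_wordsFrom.1 h2).2.2))

lemma card_wordsFrom (n : ℕ) (i : Fin d) : (wordsFrom n i).card = (d - 1) ^ n := by
  induction n generalizing i with
  | zero => simp [wordsFrom]
  | succ n ih =>
    rw [wordsFrom, Finset.card_map, Finset.card_biUnion fun i _ j _ h => disjoint_wordsFrom n h]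
    simp [ih, pow_succ, mul_comm]

/-- The reduced words of length at most `m`. -/
def shortWords (d : ℕ) : ℕ → Finset (List (Fin d))
  | 0 => {[]}
  | m + 1 => shortWords d m ∪ Finset.univ.biUnion (wordsFrom m)

lemma mem_shortWords {m : ℕ} {l : List (Fin d)} :
    l ∈ shortWords d m ↔ l.IsChain (· ≠ ·) ∧ l.length ≤ m := by
  induction m with
  | zero =>
    rw [shortWords, Finset.mem_singleton, Nat.le_zero, List.length_eq_zero_iff]
    constructor
    · rintro rfl; simp
    · exact fun h => h.2
  | succ m ih =>
    simp only [shortWords, Finset.mem_union, ih, Finset.mem_biUnion, Finset.mem_univ, true_and,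
      mem_wordsFrom]
    constructor
    · rintro (⟨h, h'⟩ | ⟨i, h, h', -⟩)
      · exact ⟨h, by omega⟩
      · exact ⟨h, by omega⟩
    · rintro ⟨h, h'⟩
      rcases Nat.lt_or_ge m l.length with hlt | hge
      · cases l with
        | nil => simp at hlt
        | cons a l => exact Or.inr ⟨a, h, by omega, rfl⟩
      · exact Or.inl ⟨h, hge⟩

lemma card_shortWords (d m : ℕ) :
    (shortWords d m).card = 1 + ∑ j ∈ Finset.range m, d * (d - 1) ^ j := by
  induction m with
  | zero => simp [shortWords]
  | succ m ih =>
    rw [shortWords, Finset.card_union_of_disjoint, ih, Finset.sum_range_succ,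
      Finset.card_biUnion fun i _ j _ h => disjoint_wordsFrom m h]
    · simp [card_wordsFrom, add_assoc]
    · refine Finset.disjoint_left.2 fun l h1 h2 => ?_
      obtain ⟨i, -, hi⟩ := Finset.mem_biUnion.1 h2
      have := (mem_shortWords.1 h1).2
      have := (mem_wordsFrom.1 hi).2.1
      omega

end Words

section WordRepresentation

lemma one_add_mul_one_add_eq_one {R : Type*} [Ring R] [Algebra (ZMod 2) R] {a : R}
    (ha : a * a = 0) : (1 + a) * (1 + a) = 1 := by
  have h : (1 + a) * (1 + a) = 1 + (a + a) + a * a := by noncomm_ring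
  rw [h, ha, add_self_eq_zero_of_algebra, add_zero, add_zero]

lemma map_mul_sub_one {Γ R : Type*} [Monoid Γ] [Ring R] (e : Γ →* R) (g h : Γ) :
    e (g * h) - 1 = (e g - 1) * (e h - 1) + (e g - 1) + (e h - 1) := by
  rw [map_mul]; noncomm_ring

variable {d : ℕ}

/-- The vector space with basis the words in `d` letters. -/
def WordSpace (d : ℕ) : Type := List (Fin d) →₀ ZMod 2

noncomputable instance (d : ℕ) : AddCommGroup (WordSpace d) :=
  inferInstanceAs (AddCommGroup (List (Fin d) →₀ ZMod 2))

noncomputable instance (d : ℕ) : Module (ZMod 2) (WordSpace d) :=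
  inferInstanceAs (Module (ZMod 2) (List (Fin d) →₀ ZMod 2))

/-- The basis of words of `WordSpace d`. -/
noncomputable def wordVec (d : ℕ) : Module.Basis (List (Fin d)) (ZMod 2) (WordSpace d) :=
  Finsupp.basisSingleOne

/-- The operator prepending the letter `i` to the words not starting with `i`, and killing the
others. -/
noncomputable def consOp (i : Fin d) : Module.End (ZMod 2) (WordSpace d) :=
  (wordVec d).constr (ZMod 2) fun l => if l.head? = some i then 0 else wordVec d (i :: l)

lemma consOp_wordVec (i : Fin d) (l : List (Fin d)) : consOp i (wordVec d l) =
    if l.head? = some i then 0 else wordVec d (i :: l) :=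
  Module.Basis.constr_basis _ _ _ _

lemma consOp_mul_self (i : Fin d) : consOp i * consOp i = 0 := by
  refine (wordVec d).ext fun l => ?_
  rw [Module.End.mul_apply, consOp_wordVec]
  split_ifs
  · simp
  · rw [consOp_wordVec]; simp

lemma one_add_consOp_mul_self (i : Fin d) : (1 + consOp i) * (1 + consOp i) = 1 :=
  one_add_mul_one_add_eq_one (consOp_mul_self i)

/-- The representation of the universal Coxeter group on words. -/
noncomputable def wordRep : UnivCoxeter d →* Module.End (ZMod 2) (WordSpace d) :=
  (Units.coeHom _).comp (UnivCoxeter.lift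
    (fun i => ⟨1 + consOp i, 1 + consOp i, one_add_consOp_mul_self i, one_add_consOp_mul_self i⟩)
    fun i => Units.ext (one_add_consOp_mul_self i))

lemma wordRep_coxGen (i : Fin d) : wordRep (coxGen i) = 1 + consOp i := by
  rw [wordRep, MonoidHom.comp_apply, UnivCoxeter.lift_coxGen]; rfl

/-- The span of the words of length at least `n`. -/
noncomputable def longWords (d n : ℕ) : Submodule (ZMod 2) (WordSpace d) :=
  Submodule.span (ZMod 2) (wordVec d '' {l | n ≤ l.length})

lemma longWords_anti {m n : ℕ} (h : m ≤ n) : longWords d n ≤ longWords d m :=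
  Submodule.span_mono (Set.image_mono fun _ hl => h.trans hl)

/-- The operators raising the length of words by at least `k`. -/
def raising (d k : ℕ) : Submodule (ZMod 2) (Module.End (ZMod 2) (WordSpace d)) where
  carrier := {f | ∀ n, ∀ v ∈ longWords d n, f v ∈ longWords d (n + k)}
  add_mem' hf hg n v hv := add_mem (hf n v hv) (hg n v hv)
  zero_mem' _ _ _ := zero_mem _
  smul_mem' c _ hf n v hv := Submodule.smul_mem _ c (hf n v hv)

lemma mul_mem_raising {a b : ℕ} {f g : Module.End (ZMod 2) (WordSpace d)}
    (hf : f ∈ raising d a) (hg : g ∈ raising d b) : f * g ∈ raising d (a + b) := fun n v hv => by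
  rw [add_comm a, ← add_assoc]
  exact hf _ _ (hg _ _ hv)

lemma raising_anti {a b : ℕ} (h : a ≤ b) : raising d b ≤ raising d a := fun _ hf n v hv =>
  longWords_anti (by omega) (hf n v hv)

lemma consOp_mem_raising (i : Fin d) : consOp i ∈ raising d 1 := fun n v hv => by
  suffices h : (longWords d n).map (consOp i) ≤ longWords d (n + 1) from
    h (Submodule.mem_map_of_mem hv)
  rw [longWords, Submodule.map_span, Submodule.span_le]
  rintro _ ⟨_, ⟨l, hl, rfl⟩, rfl⟩
  rw [SetLike.mem_coe, consOp_wordVec]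
  split_ifs
  · exact zero_mem _
  · exact Submodule.subset_span ⟨_, by simpa using hl, rfl⟩

lemma wordRep_coxGen_sub_one (i : Fin d) : wordRep (coxGen i) - 1 = consOp i := by
  rw [wordRep_coxGen, add_sub_cancel_left]

lemma wordRep_sub_one_mem (g : UnivCoxeter d) : wordRep g - 1 ∈ raising d 1 := by
  induction g using UnivCoxeter.induction with
  | one => rw [map_one, sub_self]; exact zero_mem _
  | mul g h hg hh =>
    rw [map_mul_sub_one]
    exact add_mem (add_mem (raising_anti (by omega) (mul_mem_raising hg hh)) hg) hh
  | gen i => rw [wordRep_coxGen_sub_one]; exact consOp_mem_raising i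

/-- The extension of `wordRep` to the group algebra. -/
noncomputable def wordAlgRep : MonoidAlgebra (ZMod 2) (UnivCoxeter d) →ₐ[ZMod 2]
    Module.End (ZMod 2) (WordSpace d) :=
  MonoidAlgebra.lift (ZMod 2) _ _ wordRep

local notation "δ" => MonoidAlgebra.of (ZMod 2) (UnivCoxeter d)

lemma wordAlgRep_of (g : UnivCoxeter d) : wordAlgRep (δ g) = wordRep g :=
  MonoidAlgebra.lift_of _ _

lemma wordAlgRep_mem {n : ℕ} {x : MonoidAlgebra (ZMod 2) (UnivCoxeter d)}
    (hx : x ∈ augSpace δ ^ n) : wordAlgRep x ∈ raising d n := by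
  suffices h : (augSpace δ ^ n).map wordAlgRep.toLinearMap ≤ raising d n from
    h (Submodule.mem_map_of_mem hx)
  clear hx
  induction n with
  | zero =>
    rw [pow_zero, Submodule.map_one, Submodule.one_le]
    exact fun _ _ hv => hv
  | succ n ih =>
    rw [pow_succ, Submodule.map_mul, Submodule.mul_le]
    refine fun f hf g hg => mul_mem_raising (ih hf) ?_
    suffices h : (augSpace δ).map wordAlgRep.toLinearMap ≤ raising d 1 from h hg
    rw [augSpace, Submodule.map_span, Submodule.span_le]
    rintro _ ⟨_, ⟨g, rfl⟩, rfl⟩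
    rw [AlgHom.toLinearMap_apply, map_sub, wordAlgRep_of, map_one]
    exact wordRep_sub_one_mem g

/-- The product of the elements `x_i - 1` of the group algebra, `i` running through the letters
of a word. -/
noncomputable def wordProd (l : List (Fin d)) : MonoidAlgebra (ZMod 2) (UnivCoxeter d) :=
  (l.map fun i => δ (coxGen i) - 1).prod

lemma wordProd_cons (i : Fin d) (l : List (Fin d)) :
    wordProd (i :: l) = (δ (coxGen i) - 1) * wordProd l := by simp [wordProd]

lemma wordProd_mem (l : List (Fin d)) : wordProd l ∈ augSpace δ ^ l.length := by
  induction l with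
  | nil => rw [List.length_nil, pow_zero]; exact Submodule.one_le.1 le_rfl
  | cons i l ih =>
    rw [wordProd_cons, List.length_cons, pow_succ']
    exact Submodule.mul_mem_mul (sub_one_mem_augSpace _ _) ih

lemma wordAlgRep_wordProd {l : List (Fin d)} (hl : l.IsChain (· ≠ ·)) :
    wordAlgRep (wordProd l) (wordVec d []) = wordVec d l := by
  induction l with
  | nil => simp [wordProd]
  | cons i l ih =>
    rw [List.isChain_cons] at hl
    rw [wordProd_cons, map_mul, Module.End.mul_apply, ih hl.2, map_sub, map_one, wordAlgRep_of,
      wordRep_coxGen_sub_one, consOp_wordVec, if_neg]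
    exact fun h => hl.1 i h rfl

lemma augSpace_le_span_coxGen : augSpace δ ≤
    Submodule.span (ZMod 2) (Set.range fun i => δ (coxGen i) - 1) ⊔ augSpace δ ^ 2 := by
  conv_lhs => rw [augSpace]
  rw [Submodule.span_le]
  rintro _ ⟨g, rfl⟩
  simp only [SetLike.mem_coe]
  induction g using UnivCoxeter.induction with
  | one => rw [map_one, sub_self]; exact zero_mem _
  | mul g h hg hh =>
    rw [map_mul_sub_one]
    refine add_mem (add_mem (Submodule.mem_sup_right ?_) hg) hh
    rw [pow_two]
    exact Submodule.mul_mem_mul (sub_one_mem_augSpace _ _) (sub_one_mem_augSpace _ _)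
  | gen i => exact Submodule.mem_sup_left (Submodule.subset_span ⟨i, rfl⟩)

lemma wordProd_eq_zero {i : Fin d} {l : List (Fin d)} (h : l.head? = some i) :
    wordProd (i :: l) = 0 := by
  cases l with
  | nil => simp at h
  | cons j l =>
    obtain rfl : j = i := by simpa using h
    rw [wordProd_cons, wordProd_cons, ← mul_assoc, ← map_mul_self_sub_one, coxGen_mul_self,
      map_one, sub_self, zero_mul]

lemma pow_le_span_wordProd (n : ℕ) : augSpace δ ^ n ≤
    Submodule.span (ZMod 2) (wordProd '' {l | l.IsChain (· ≠ ·) ∧ l.length = n}) ⊔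
      augSpace δ ^ (n + 1) := by
  induction n with
  | zero =>
    refine le_sup_of_le_left ?_
    rw [pow_zero, Submodule.one_eq_span, Submodule.span_le, Set.singleton_subset_iff]
    exact Submodule.subset_span ⟨[], by simp, by simp [wordProd]⟩
  | succ n ih =>
    set A := Submodule.span (ZMod 2) (wordProd '' {l : List (Fin d) | l.IsChain (· ≠ ·) ∧
      l.length = n}) with hA
    have hA' : A ≤ augSpace δ ^ n := by
      rw [hA, Submodule.span_le]
      rintro _ ⟨l, ⟨-, rfl⟩, rfl⟩
      exact wordProd_mem l
    calc augSpace δ ^ (n + 1) = augSpace δ * augSpace δ ^ n := pow_succ' _ _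
      _ ≤ augSpace δ * (A ⊔ augSpace δ ^ (n + 1)) := mul_le_mul_right ih _
      _ = augSpace δ * A ⊔ augSpace δ ^ (n + 1 + 1) := by rw [Submodule.mul_sup, ← pow_succ']
      _ ≤ _ := by
        refine sup_le ((mul_le_mul_left augSpace_le_span_coxGen _).trans ?_) le_sup_right
        rw [Submodule.sup_mul]
        refine sup_le_sup ?_ ?_
        · rw [hA, Submodule.span_mul_span, Submodule.span_le]
          rintro _ ⟨_, ⟨i, rfl⟩, _, ⟨l, ⟨hl, rfl⟩, rfl⟩, rfl⟩
          simp only [← wordProd_cons]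
          by_cases h : l.head? = some i
          · rw [wordProd_eq_zero h]; exact zero_mem _
          · refine Submodule.subset_span ⟨i :: l, ⟨List.isChain_cons.2 ⟨?_, hl⟩, by simp⟩, rfl⟩
            rintro y hy rfl
            exact h hy
        · rw [show n + 1 + 1 = 2 + n by ring, pow_add]
          exact mul_le_mul_right hA' _

lemma top_le_span_wordProd (m : ℕ) :
    ⊤ ≤ Submodule.span (ZMod 2) (Set.range fun l : shortWords d m => wordProd l.1) ⊔
      augSpace δ ^ (m + 1) := by
  induction m with
  | zero =>
    rintro x -
    induction x using MonoidAlgebra.induction_on with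
    | of g =>
      rw [← add_sub_cancel 1 (δ g)]
      refine Submodule.add_mem_sup (Submodule.subset_span ⟨⟨[], ?_⟩, ?_⟩) ?_
      · exact mem_shortWords.2 (by simp)
      · simp [wordProd]
      · exact sub_one_mem_augSpace_pow_one _ _
    | add x y hx hy => exact add_mem hx hy
    | smul c x hx => exact Submodule.smul_mem _ c hx
  | succ m ih =>
    refine ih.trans (sup_le (le_sup_of_le_left (Submodule.span_mono ?_))
      ((pow_le_span_wordProd _).trans (sup_le_sup_right (Submodule.span_mono ?_) _)))
    · rintro _ ⟨⟨l, hl⟩, rfl⟩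
      have h := mem_shortWords.1 hl
      exact ⟨⟨l, mem_shortWords.2 ⟨h.1, by omega⟩⟩, rfl⟩
    · rintro _ ⟨l, ⟨h, h'⟩, rfl⟩
      exact ⟨⟨l, mem_shortWords.2 ⟨h, h'.le⟩⟩, rfl⟩

variable (d)

/-- The reduced words of length at most `m` give a basis of the group algebra modulo
`I ^ (m + 1)`. -/
noncomputable def wordBasis (m : ℕ) : Module.Basis (shortWords d m) (ZMod 2)
    (MonoidAlgebra (ZMod 2) (UnivCoxeter d) ⧸
      augSpace (MonoidAlgebra.of (ZMod 2) (UnivCoxeter d)) ^ (m + 1)) :=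
  Module.Basis.mk (v := fun l => (augSpace δ ^ (m + 1)).mkQ (wordProd l.1))
    (by
      let φ : MonoidAlgebra (ZMod 2) (UnivCoxeter d) →ₗ[ZMod 2] (shortWords d m → ZMod 2) :=
        LinearMap.pi fun l => (wordVec d).coord l.1 ∘ₗ
          LinearMap.applyₗ (wordVec d []) ∘ₗ wordAlgRep.toLinearMap
      have hφ : augSpace δ ^ (m + 1) ≤ LinearMap.ker φ := by
        intro x hx
        ext l
        have h1 := wordAlgRep_mem hx 0 (wordVec d [])
          (Submodule.subset_span ⟨[], by simp, rfl⟩)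
        rw [longWords, Module.Basis.mem_span_image] at h1
        refine Finsupp.notMem_support_iff.1 fun h2 => ?_
        have h3 := h1 h2
        have := (mem_shortWords.1 l.2).2
        simp only [Set.mem_ofPred_eq] at h3
        omega
      refine LinearIndependent.of_comp ((augSpace δ ^ (m + 1)).liftQ φ hφ) ?_
      have : (⇑((augSpace δ ^ (m + 1)).liftQ φ hφ) ∘
          fun l : shortWords d m => (augSpace δ ^ (m + 1)).mkQ (wordProd l.1)) =
          fun l => Pi.single l 1 := by
        funext l k
        have h1 : (wordVec d).coord k.1 (wordAlgRep (wordProd l.1) (wordVec d [])) =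
            (wordVec d).coord k.1 (wordVec d l.1) := by
          rw [wordAlgRep_wordProd (mem_shortWords.1 l.2).1]
        refine h1.trans ?_
        rw [Module.Basis.coord_apply, Module.Basis.repr_self, Finsupp.single_apply,
          Pi.single_apply]
        exact if_congr (by rw [Subtype.ext_iff, eq_comm]) rfl rfl
      rw [this]
      exact Pi.linearIndependent_single_one _ _)
    (by
      have h := Submodule.map_mono (f := (augSpace δ ^ (m + 1)).mkQ) (top_le_span_wordProd m)
      rw [Submodule.map_sup, Submodule.map_top, Submodule.range_mkQ, Submodule.map_span,
        Submodule.mkQ_map_self, sup_bot_eq, ← Set.range_comp] at h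
      exact h)

instance finite_quotient_augSpace (n : ℕ) : Module.Finite (ZMod 2)
    (MonoidAlgebra (ZMod 2) (UnivCoxeter d) ⧸
      augSpace (MonoidAlgebra.of (ZMod 2) (UnivCoxeter d)) ^ (n + 1)) :=
  Module.Finite.of_basis (wordBasis d n)

lemma finrank_quotient_augSpace (m : ℕ) : Module.finrank (ZMod 2)
    (MonoidAlgebra (ZMod 2) (UnivCoxeter d) ⧸
      augSpace (MonoidAlgebra.of (ZMod 2) (UnivCoxeter d)) ^ (m + 1)) =
    1 + ∑ j ∈ Finset.range m, d * (d - 1) ^ j := by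
  rw [Module.finrank_eq_card_basis (wordBasis d m), Fintype.card_coe, card_shortWords]

end WordRepresentation

section Asymptotics

/-- The rank of the `n`-th layer of the Zassenhaus filtration of the universal Coxeter group. -/
noncomputable abbrev coxRank (d n : ℕ) : ℕ := layerRank (MonoidAlgebra.of (ZMod 2) (UnivCoxeter d)) n

open PowerSeries in
lemma coeff_prod_coxRank (d : ℕ) (hd : 1 ≤ d) {n j : ℕ} (hj : j ≤ n) :
    coeff j (∏ i ∈ Finset.range n, (1 + X ^ (i + 1) : PowerSeries ℝ) ^ coxRank d i) =
      coeff j ((1 + X) * geomSeries ((d : ℝ) - 1)) := by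
  have key : ∀ m ≤ n, ∑ j ∈ Finset.range (m + 1),
      coeff j (∏ i ∈ Finset.range n, (1 + X ^ (i + 1) : PowerSeries ℝ) ^ coxRank d i) =
      1 + ∑ j ∈ Finset.range m, (d : ℝ) * ((d : ℝ) - 1) ^ j := fun m hm => by
    rw [← finrank_quotient_eq_sum_coeff hm, finrank_quotient_augSpace]
    push_cast [Nat.cast_sub hd]
    rfl
  cases j with
  | zero =>
    have h := key 0 hj
    rw [Finset.sum_range_one, Finset.sum_range_zero, add_zero] at h
    rw [h, add_mul, one_mul, map_add, coeff_zero_X_mul]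
    simp [geomSeries]
  | succ j =>
    have h := key (j + 1) hj
    rw [Finset.sum_range_succ, key j (by omega), Finset.sum_range_succ] at h
    rw [add_mul, one_mul, map_add, coeff_succ_X_mul]
    simp only [geomSeries, coeff_mk]
    rw [pow_succ]
    linarith

lemma coxRank_le (d : ℕ) (hd : 3 ≤ d) (n : ℕ) :
    (coxRank d n : ℝ) ≤ 3 * ((d : ℝ) - 1) ^ (n + 1) := by
  have hq : (3 : ℝ) ≤ d := by exact_mod_cast hd
  have h : ∀ m, 1 + ∑ j ∈ Finset.range m, (d : ℝ) * ((d : ℝ) - 1) ^ j ≤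
      3 * ((d : ℝ) - 1) ^ m := fun m => by
    induction m with
    | zero => norm_num
    | succ m ih =>
      have : 0 ≤ ((d : ℝ) - 1) ^ m := pow_nonneg (by linarith) _
      rw [Finset.sum_range_succ, pow_succ]
      nlinarith
  refine le_trans ?_ (h (n + 1))
  have h1 := layerRank_le (MonoidAlgebra.of (ZMod 2) (UnivCoxeter d)) n
  rw [finrank_quotient_augSpace] at h1
  have h2 : (coxRank d n : ℝ) ≤ ((1 + ∑ j ∈ Finset.range (n + 1), d * (d - 1) ^ j : ℕ) : ℝ) := by
    exact_mod_cast h1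
  push_cast [Nat.cast_sub (show 1 ≤ d by omega)] at h2
  exact h2

lemma abs_mul_coxRank_sub_pow_le (d : ℕ) (hd : 3 ≤ d) (n : ℕ) :
    |((n : ℝ) + 1) * coxRank d n - ((d : ℝ) - 1) ^ (n + 1)| ≤
      1 + 3 * ((n : ℝ) + 1) ^ 2 * ((d : ℝ) - 1) ^ ((n + 1) / 2) :=
  abs_mul_sub_pow_le (coxRank d) (by have : (3 : ℝ) ≤ d := by exact_mod_cast hd
                                     linarith)
    (fun _ hj => coeff_prod_coxRank d (by omega) hj) (coxRank_le d hd)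

open Filter Topology

lemma tendsto_mul_coxRank_div_pow (d : ℕ) (hd : 3 ≤ d) :
    Tendsto (fun n : ℕ => ((n : ℝ) + 1) * coxRank d n / ((d : ℝ) - 1) ^ (n + 1)) atTop (𝓝 1) := by
  have hq : (2 : ℝ) ≤ (d : ℝ) - 1 := by
    have : (3 : ℝ) ≤ d := by exact_mod_cast hd
    linarith
  set q : ℝ := (d : ℝ) - 1 with hqdef
  set r : ℝ := (√q)⁻¹ with hr
  have hs : 1 < √q := by
    rw [Real.lt_sqrt zero_le_one]
    linarith
  have hr1 : |r| < 1 := by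
    rw [abs_of_pos (by positivity)]
    exact inv_lt_one_of_one_lt₀ hs
  have hlim : Tendsto (fun n : ℕ => 4 * (((n + 1 : ℕ) : ℝ) ^ 2 * r ^ (n + 1))) atTop (𝓝 0) := by
    simpa using ((tendsto_add_atTop_iff_nat 1).2
      (tendsto_pow_const_mul_const_pow_of_abs_lt_one 2 hr1)).const_mul 4
  refine tendsto_iff_norm_sub_tendsto_zero.2 (squeeze_zero (fun _ => norm_nonneg _)
    (fun n => ?_) hlim)
  have hq0 : 0 < q ^ (n + 1) := by positivity
  have hsq : q ^ (n + 1) = √q ^ (n + 1) * √q ^ (n + 1) := by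
    rw [← mul_pow, Real.mul_self_sqrt (by linarith)]
  have hfloor : q ^ ((n + 1) / 2) ≤ √q ^ (n + 1) := by
    calc q ^ ((n + 1) / 2) = √q ^ (2 * ((n + 1) / 2)) := by
          rw [pow_mul, Real.sq_sqrt (by linarith)]
      _ ≤ _ := pow_le_pow_right₀ hs.le (by omega)
  have hone : 1 ≤ √q ^ (n + 1) := one_le_pow₀ hs.le
  have hn : (1 : ℝ) ≤ ((n : ℝ) + 1) ^ 2 := one_le_pow₀ (by linarith [n.cast_nonneg (α := ℝ)])
  rw [Real.norm_eq_abs, div_sub_one hq0.ne', abs_div, abs_of_pos hq0, div_le_iff₀ hq0]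
  refine (abs_mul_coxRank_sub_pow_le d hd n).trans ?_
  have : r ^ (n + 1) * q ^ (n + 1) = √q ^ (n + 1) := by
    rw [hsq, ← mul_assoc, ← mul_pow, hr, inv_mul_cancel₀ (by positivity), one_pow, one_mul]
  rw [← hqdef, mul_assoc 3, mul_assoc 4, mul_assoc _ (r ^ (n + 1)), this]
  push_cast
  nlinarith [mul_le_mul_of_nonneg_left hfloor (show (0 : ℝ) ≤ ((n : ℝ) + 1) ^ 2 by positivity),
    mul_le_mul hn hone zero_le_one (by positivity)]

lemma eventually_mul_coxRank_le (d : ℕ) (hd : 3 ≤ d) {p : ℝ} (hp : p < (d : ℝ) - 1) :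
    ∀ᶠ n in atTop, 0 < coxRank d n ∧ p * coxRank d n ≤ coxRank d (n + 1) := by
  have hq : (0 : ℝ) < (d : ℝ) - 1 := by
    have : (3 : ℝ) ≤ d := by exact_mod_cast hd
    linarith
  have h := tendsto_mul_coxRank_div_pow d hd
  set q : ℝ := (d : ℝ) - 1
  have h' := (tendsto_add_atTop_iff_nat 1).2 h
  have hfrac : Tendsto (fun n : ℕ => ((n : ℝ) + 1) / ((n : ℝ) + 1 + 1)) atTop (𝓝 1) := by
    have := (tendsto_add_atTop_iff_nat 1).2 (tendsto_natCast_div_add_atTop (1 : ℝ))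
    simpa using this
  have hlim := ((h'.div h one_ne_zero).mul hfrac).const_mul q
  rw [div_one, mul_one, mul_one] at hlim
  filter_upwards [hlim.eventually_const_lt hp, h.eventually_const_lt zero_lt_one] with n h1 h2
  have hpos : (0 : ℝ) < coxRank d n := by
    by_contra! h3
    refine absurd h2 (not_lt.2 (div_nonpos_of_nonpos_of_nonneg
      (mul_nonpos_of_nonneg_of_nonpos (by positivity) h3) (by positivity)))
  refine ⟨by exact_mod_cast hpos, ?_⟩
  rw [← le_div_iff₀ hpos]
  refine h1.le.trans_eq ?_
  simp only [Pi.div_apply]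
  push_cast
  field_simp
  ring

lemma exists_sum_coxRank_le (d : ℕ) (hd : 3 ≤ d) {p : ℝ} (hp1 : 1 < p) (hp : p < (d : ℝ) - 1) :
    ∃ C : ℝ, 0 ≤ C ∧ ∃ n₀ : ℕ, 1 ≤ n₀ ∧ ∀ n ≥ n₀, p * coxRank d n ≤ coxRank d (n + 1) ∧
      (p - 1) * ∑ i ∈ Finset.range n, (coxRank d i : ℝ) ≤ C + coxRank d n := by
  obtain ⟨n₀, hn₀⟩ := eventually_atTop.1 (eventually_mul_coxRank_le d hd hp)
  refine ⟨(p - 1) * ∑ i ∈ Finset.range (n₀ + 1), (coxRank d i : ℝ),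
    mul_nonneg (by linarith) (Finset.sum_nonneg fun _ _ => by positivity), n₀ + 1, by omega,
    fun n hn => ⟨(hn₀ n (by omega)).2, ?_⟩⟩
  induction n, hn using Nat.le_induction with
  | base => simp
  | succ n hn ih =>
    have := (hn₀ n (by omega)).2
    rw [Finset.sum_range_succ]
    linarith

/-- The numerical estimate behind the rank bound: here `k` is the logarithm of the index of a
subgroup between two consecutive terms of the Zassenhaus filtration, and `j` that of its index in
the larger one. -/
lemma exists_rank_bound (d : ℕ) (hd : 3 ≤ d) {ε : ℝ} (hε : 0 < ε) : ∃ k₀ : ℕ, ∀ n j : ℕ,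
    j ≤ coxRank d n → k₀ ≤ ∑ i ∈ Finset.range n, coxRank d i + j → 1 ≤ n ∧ ∀ E : ℝ,
      (coxRank d n : ℝ) - j ≤ E →
      (coxRank d (n + 1) : ℝ) - ((d : ℝ) - 1) * ((coxRank d n : ℝ) - j) ≤ E →
      (((d : ℝ) - 2) / 2 - ε) * (∑ i ∈ Finset.range n, coxRank d i + j : ℕ) ≤ E := by
  have hd' : (3 : ℝ) ≤ d := by exact_mod_cast hd
  set η : ℝ := min (1 / 2) (2 * ε / d) with hη
  have hη0 : 0 < η := lt_min (by norm_num) (by positivity)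
  have hη1 : η ≤ 1 / 2 := min_le_left _ _
  have hη2 : η * d ≤ 2 * ε := (le_div_iff₀ (by linarith)).1 (min_le_right _ _)
  obtain ⟨C, hC, n₀, h1, h⟩ := exists_sum_coxRank_le d hd (p := d - 1 - η) (by linarith)
    (by linarith)
  obtain ⟨K, hK⟩ := exists_nat_ge (C / ε)
  rw [div_le_iff₀ hε] at hK
  refine ⟨max K (∑ i ∈ Finset.range n₀, coxRank d i + 1), fun n j hj hk => ?_⟩
  have hn : n₀ ≤ n := by
    by_contra! hlt
    have : ∑ i ∈ Finset.range (n + 1), coxRank d i ≤ ∑ i ∈ Finset.range n₀, coxRank d i :=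
      Finset.sum_le_sum_of_subset (Finset.range_mono hlt)
    rw [Finset.sum_range_succ] at this
    have := (le_max_right _ _).trans hk
    omega
  obtain ⟨h2, h3⟩ := h n hn
  refine ⟨h1.trans hn, fun E hE1 hE2 => ?_⟩
  have hkK : (K : ℝ) ≤ (∑ i ∈ Finset.range n, coxRank d i + j : ℕ) := by
    exact_mod_cast (le_max_left _ _).trans hk
  have hjL : (j : ℝ) ≤ coxRank d n := by exact_mod_cast hj
  push_cast at *
  set N : ℝ := ∑ i ∈ Finset.range n, (coxRank d i : ℝ)
  set L : ℝ := (coxRank d n : ℝ)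
  set D : ℝ := (d : ℝ)
  have hk0 : 0 ≤ N + j := K.cast_nonneg.trans hkK
  have h5 : (D - 2 - η) * (N + j) - C ≤ (2 + η) * E := by nlinarith
  have h6 : C ≤ ε * (N + j) := by nlinarith
  have h7 : (2 + η) * ((D - 2) / 2 - ε) ≤ D - 2 - η - ε := by nlinarith
  have h8 := mul_le_mul_of_nonneg_right h7 hk0
  nlinarith

end Asymptotics

section LayerComap

variable {Γ R : Type*} [Group Γ] [Ring R] [Algebra (ZMod 2) R] (e : Γ →* R)

/-- The elements of `M` whose image in the layer lies in a given subspace. -/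
def layerComap {n : ℕ} (M : Subgroup Γ) (hM : M ≤ dimSubgroup e n)
    (Z : Submodule (ZMod 2) (R ⧸ augSpace e ^ (n + 2))) : Subgroup Γ :=
  (Z.toAddSubgroup.toSubgroup.comap (layerHom e M hM)).map M.subtype

lemma mem_layerComap {n : ℕ} {M : Subgroup Γ} {hM : M ≤ dimSubgroup e n}
    {Z : Submodule (ZMod 2) (R ⧸ augSpace e ^ (n + 2))} {g : Γ} :
    g ∈ layerComap e M hM Z ↔ g ∈ M ∧ Submodule.Quotient.mk (e g - 1) ∈ Z := by
  constructor
  · rintro ⟨g, hg, rfl⟩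
    exact ⟨g.2, hg⟩
  · rintro ⟨h, h'⟩
    exact ⟨⟨g, h⟩, h', rfl⟩

lemma dimSubgroup_succ_le_layerComap {n : ℕ} {M : Subgroup Γ} (hM : M ≤ dimSubgroup e n)
    (hM' : dimSubgroup e (n + 1) ≤ M) (Z : Submodule (ZMod 2) (R ⧸ augSpace e ^ (n + 2))) :
    dimSubgroup e (n + 1) ≤ layerComap e M hM Z := fun g hg => by
  rw [mem_layerComap, (Submodule.Quotient.mk_eq_zero _).2 ((mem_dimSubgroup e).1 hg)]
  exact ⟨hM' hg, zero_mem _⟩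

open scoped commutatorElement in
lemma normal_of_dimSubgroup_le {n : ℕ} {M : Subgroup Γ} (hM : M ≤ dimSubgroup e n)
    (hM' : dimSubgroup e (n + 1) ≤ M) : M.Normal where
  conj_mem g hg h := by
    have h1 : ⁅h, g⁆ ∈ dimSubgroup e (0 + n + 1) :=
      commutator_mem_dimSubgroup e (by rw [dimSubgroup_zero]; trivial) (hM hg)
    rw [zero_add] at h1
    have h2 : h * g * h⁻¹ = ⁅h, g⁆ * g := by rw [commutatorElement_def]; group
    rw [h2]
    exact mul_mem (hM' h1) hg

lemma exists_relIndex_eq_two {n : ℕ} {M : Subgroup Γ} (hM : M ≤ dimSubgroup e n)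
    (hM' : dimSubgroup e (n + 1) ≤ M) (hne : ¬ M ≤ dimSubgroup e (n + 1)) :
    ∃ K ≤ M, dimSubgroup e (n + 1) ≤ K ∧ K.relIndex M = 2 := by
  obtain ⟨a, ha, hane⟩ := SetLike.not_le_iff_exists.1 hne
  obtain ⟨φ, hφ⟩ : ∃ φ : Module.Dual (ZMod 2) (R ⧸ augSpace e ^ (n + 2)),
      φ (Submodule.Quotient.mk (e a - 1)) ≠ 0 := by
    by_contra! h
    rw [Module.forall_dual_apply_eq_zero_iff, Submodule.Quotient.mk_eq_zero] at h
    exact hane h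
  refine ⟨layerComap e M hM (LinearMap.ker φ), fun g hg => ((mem_layerComap e).1 hg).1,
    dimSubgroup_succ_le_layerComap e hM hM' _, ?_⟩
  rw [Subgroup.relIndex, Subgroup.index_eq_two_iff]
  refine ⟨⟨a, ha⟩, fun b => ?_⟩
  have hmul : φ (Submodule.Quotient.mk (e (b * a : Γ) - 1)) =
      φ (Submodule.Quotient.mk (e b - 1)) + φ (Submodule.Quotient.mk (e a - 1)) := by
    rw [← map_add]
    exact congrArg φ ((layerHom e M hM).map_mul b ⟨a, ha⟩)
  simp only [Subgroup.mem_subgroupOf, mem_layerComap, LinearMap.mem_ker, Subgroup.coe_mul, hmul,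
    b.2, mul_mem b.2 ha, true_and]
  generalize φ (Submodule.Quotient.mk (e a - 1)) = x at *
  generalize φ (Submodule.Quotient.mk (e b - 1)) = y at *
  clear hmul
  revert x y
  decide

/-- Refining the Zassenhaus filtration to a chain of subgroups of index two. -/
lemma exists_chain_of_index_two
    [∀ n, Module.Finite (ZMod 2) (R ⧸ augSpace e ^ (n + 1))]
    (hL : ∀ m, ∃ n ≥ m, 0 < layerRank e n) :
    ∃ H : ℕ → Subgroup Γ, H 0 = ⊤ ∧ (∀ k, H (k + 1) ≤ H k) ∧ (∀ k, (H k).index = 2 ^ k) ∧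
      ∀ k, ∃ n, dimSubgroup e (n + 1) ≤ H k ∧ H k ≤ dimSubgroup e n := by
  have step : ∀ M : {M : Subgroup Γ // ∃ n, dimSubgroup e (n + 1) ≤ M ∧ M ≤ dimSubgroup e n},
      ∃ K : {M : Subgroup Γ // ∃ n, dimSubgroup e (n + 1) ≤ M ∧ M ≤ dimSubgroup e n},
        K.1 ≤ M.1 ∧ K.1.relIndex M.1 = 2 := by
    rintro ⟨M, m, hm, hm'⟩
    have hex : ∃ n, ¬ M ≤ dimSubgroup e (n + 1) := by
      obtain ⟨n, hn, hpos⟩ := hL (m + 1)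
      refine ⟨n, fun h => ?_⟩
      have h1 := relIndex_dimSubgroup e n
      rw [Subgroup.relIndex_eq_one.2 (((dimSubgroup_anti e hn).trans hm).trans h)] at h1
      exact absurd h1 (Nat.one_lt_two_pow hpos.ne').ne
    classical
    obtain ⟨n, hn, hmin⟩ : ∃ n, ¬ M ≤ dimSubgroup e (n + 1) ∧ M ≤ dimSubgroup e n := by
      refine ⟨Nat.find hex, Nat.find_spec hex, ?_⟩
      rcases Nat.eq_zero_or_pos (Nat.find hex) with h0 | hpos
      · rw [h0, dimSubgroup_zero]; exact le_top
      · have := Nat.find_min hex (Nat.sub_lt hpos one_pos)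
        rwa [not_not, show Nat.find hex - 1 + 1 = Nat.find hex by omega] at this
    have hmn : m ≤ n := by
      by_contra! h
      exact hn (hm'.trans (dimSubgroup_anti e h))
    obtain ⟨K, h1, h2, h3⟩ := exists_relIndex_eq_two e hmin
      ((dimSubgroup_anti e (by omega)).trans hm) hn
    exact ⟨⟨K, n, h2, h1.trans hmin⟩, h1, h3⟩
  choose f hf hf' using step
  let H : ℕ → {M : Subgroup Γ // ∃ n, dimSubgroup e (n + 1) ≤ M ∧ M ≤ dimSubgroup e n} :=
    fun k => f^[k] ⟨⊤, 0, le_top, (dimSubgroup_zero e).ge⟩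
  have hH : ∀ k, H (k + 1) = f (H k) := fun k => Function.iterate_succ_apply' _ _ _
  refine ⟨fun k => (H k).1, rfl, fun k => ?_, fun k => ?_, fun k => (H k).2⟩
  · simp only [hH]; exact hf _
  · induction k with
    | zero => exact Subgroup.index_top
    | succ k ih =>
      simp only [hH] at ih ⊢
      rw [← Subgroup.relIndex_mul_index (hf _), hf', ih, pow_succ']

end LayerComap

section CommSq

open scoped commutatorElement

/-- `[M, G] M²` has finite index in a finitely generated subgroup `M`. -/
lemma finite_quotient_commSq {G : Type*} [Group G] (M : Subgroup G) [Group.FG M] :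
    Finite (M ⧸ (commSq M).subgroupOf M) := by
  have hn : ((commSq M).subgroupOf M).Normal := ⟨fun n hn g => by
    rw [Subgroup.mem_subgroupOf] at *
    have h : ((g * n * g⁻¹ : M) : G) = ⁅(g : G), (n : G)⁆ * n := by
      rw [commutatorElement_def]; push_cast; group
    rw [h]
    exact mul_mem (Subgroup.mem_sup_left
      (Subgroup.commutator_mem_commutator g.2 (Subgroup.mem_top _))) hn⟩
  have hsq : ∀ x : M ⧸ (commSq M).subgroupOf M, x * x = 1 := fun x => by
    obtain ⟨g, rfl⟩ := QuotientGroup.mk_surjective x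
    rw [← QuotientGroup.mk_mul, QuotientGroup.eq_one_iff, Subgroup.mem_subgroupOf]
    exact Subgroup.mem_sup_right (Subgroup.subset_closure ⟨g, g.2, rfl⟩)
  let _ : CommGroup (M ⧸ (commSq M).subgroupOf M) :=
    { mul_comm := fun a b => by
        have h : ∀ x : M ⧸ (commSq M).subgroupOf M, x⁻¹ = x :=
          fun x => inv_eq_of_mul_eq_one_right (hsq x)
        rw [← h (a * b), mul_inv_rev, h, h] }
  exact CommGroup.finite_of_fg_isMulTorsion _ fun x =>
    isOfFinOrder_iff_pow_eq_one.2 ⟨2, two_pos, by rw [pow_two, hsq]⟩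

instance (d : ℕ) : Group.FG (UnivCoxeter d) :=
  ⟨(Subgroup.fg_iff _).2 ⟨_, closure_range_coxGen, Set.finite_range _⟩⟩

lemma mul_sub_mul_mem {A : Type*} [Ring A] [Algebra (ZMod 2) A] {S T P Q Z : Submodule (ZMod 2) A}
    (h : ∀ s ∈ S, ∀ t ∈ T, s * t - t * s ∈ Z) (hSQ : S * Q ≤ Z) (hQS : Q * S ≤ Z)
    (hPT : P * (T ⊔ Q) ≤ Z) (hTP : (T ⊔ Q) * P ≤ Z) {u v : A} (hu : u ∈ S ⊔ P) (hv : v ∈ T ⊔ Q) :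
    u * v - v * u ∈ Z := by
  obtain ⟨s, hs, p, hp, rfl⟩ := Submodule.mem_sup.1 hu
  have h1 : s * v - v * s ∈ Z := by
    obtain ⟨t, ht, q, hq, rfl⟩ := Submodule.mem_sup.1 hv
    have : s * (t + q) - (t + q) * s = (s * t - t * s) + s * q - q * s := by noncomm_ring
    rw [this]
    exact sub_mem (add_mem (h s hs t ht) (hSQ (Submodule.mul_mem_mul hs hq)))
      (hQS (Submodule.mul_mem_mul hq hs))
  have : (s + p) * v - v * (s + p) = (s * v - v * s) + p * v - v * p := by noncomm_ring
  rw [this]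
  exact sub_mem (add_mem h1 (hPT (Submodule.mul_mem_mul hp hv)))
    (hTP (Submodule.mul_mem_mul hv hp))

lemma bracket_mem_of_mem_span {A ι κ : Type*} [Ring A] [Algebra (ZMod 2) A] {b : ι → A}
    {c : κ → A} {Z : Submodule (ZMod 2) A} (h : ∀ i j, b i * c j - c j * b i ∈ Z) {s t : A}
    (hs : s ∈ Submodule.span (ZMod 2) (Set.range b))
    (ht : t ∈ Submodule.span (ZMod 2) (Set.range c)) : s * t - t * s ∈ Z := by
  induction hs using Submodule.span_induction with
  | mem s hs =>
    obtain ⟨i, rfl⟩ := hs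
    induction ht using Submodule.span_induction with
    | mem t ht => obtain ⟨j, rfl⟩ := ht; exact h i j
    | zero => simp
    | add x y _ _ hx hy =>
      rw [show b i * (x + y) - (x + y) * b i = (b i * x - x * b i) + (b i * y - y * b i) by
        noncomm_ring]
      exact add_mem hx hy
    | smul a x _ hx =>
      rw [mul_smul_comm, smul_mul_assoc, ← smul_sub]
      exact Submodule.smul_mem _ a hx
  | zero => simp
  | add x y _ _ hx hy =>
    rw [show (x + y) * t - t * (x + y) = (x * t - t * x) + (y * t - t * y) by noncomm_ring]
    exact add_mem hx hy
  | smul a x _ hx =>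
    rw [mul_smul_comm, smul_mul_assoc, ← smul_sub]
    exact Submodule.smul_mem _ a hx

variable {Γ R : Type*} [Group Γ] [Ring R] [Algebra (ZMod 2) R] (e : Γ →* R)

lemma commutator_sub_one_mem_of_bracket_mem {n : ℕ} {g w : Γ} (hg : g ∈ dimSubgroup e n)
    {S T Z : Submodule (ZMod 2) R} (hS : S ≤ augSpace e ^ (n + 1)) (hT : T ≤ augSpace e)
    (hZ : augSpace e ^ (n + 3) ≤ Z) (h : ∀ s ∈ S, ∀ t ∈ T, s * t - t * s ∈ Z)
    (hgS : e g - 1 ∈ S ⊔ augSpace e ^ (n + 2)) (hwT : e w - 1 ∈ T ⊔ augSpace e ^ 2) :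
    e ⁅g, w⁆ - 1 ∈ Z := by
  have hw : w ∈ dimSubgroup e 0 := by rw [dimSubgroup_zero]; exact Subgroup.mem_top w
  have h1 := commutator_sub_mem e hg hw
  rw [add_zero] at h1
  have hTQ : T ⊔ augSpace e ^ 2 ≤ augSpace e :=
    sup_le hT ((pow_two _).trans_le (augSpace_mul_self_le e))
  have h2 : (e g - 1) * (e w - 1) - (e w - 1) * (e g - 1) ∈ Z := by
    refine mul_sub_mul_mem h ?_ ?_ ?_ ?_ hgS hwT
    · rw [show n + 3 = n + 1 + 2 by ring, pow_add] at hZ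
      exact (mul_le_mul_left hS _).trans hZ
    · rw [show n + 3 = 2 + (n + 1) by ring, pow_add] at hZ
      exact (mul_le_mul_right hS _).trans hZ
    · rw [show n + 3 = n + 2 + 1 by ring, pow_succ] at hZ
      exact (mul_le_mul_right hTQ _).trans hZ
    · rw [show n + 3 = n + 2 + 1 by ring, pow_succ'] at hZ
      exact (mul_le_mul_left hTQ _).trans hZ
  have h3 := add_mem (hZ h1) h2
  rwa [sub_add_cancel] at h3

/-- The image of `[M, Γ] M²` in the next layer lies in a space spanned by `d · m` brackets, where
`m` is the dimension of the layer of `M`. -/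
lemma exists_commSq_le_layerComap {n d : ℕ} [Module.Finite (ZMod 2) (R ⧸ augSpace e ^ (n + 2))]
    {x : Fin d → Γ} (hx : augSpace e ≤
      Submodule.span (ZMod 2) (Set.range fun i => e (x i) - 1) ⊔ augSpace e ^ 2)
    (hn : 1 ≤ n) (M : Subgroup Γ) (hM : M ≤ dimSubgroup e n) :
    ∃ Z : Submodule (ZMod 2) (R ⧸ augSpace e ^ (n + 1 + 2)),
      Module.finrank (ZMod 2) Z ≤ d * Module.finrank (ZMod 2) (layerSpace e M hM) ∧
      commSq M ≤ layerComap e (dimSubgroup e (n + 1)) le_rfl Z := by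
  obtain ⟨b, hbM, hb⟩ := exists_layer_basis e M hM
  let c : Fin (Module.finrank (ZMod 2) (layerSpace e M hM)) × Fin d →
      R ⧸ augSpace e ^ (n + 1 + 2) := fun p => Submodule.Quotient.mk
    ((e (b p.1) - 1) * (e (x p.2) - 1) - (e (x p.2) - 1) * (e (b p.1) - 1))
  refine ⟨Submodule.span (ZMod 2) (Set.range c), ?_, ?_⟩
  · refine (finrank_range_le_card c).trans ?_
    rw [Fintype.card_prod, Fintype.card_fin, Fintype.card_fin, mul_comm]
  refine sup_le (Subgroup.commutator_le.2 fun g hg w _ => ?_) ((Subgroup.closure_le _).2 ?_)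
  · have hw : w ∈ dimSubgroup e 0 := by rw [dimSubgroup_zero]; exact Subgroup.mem_top w
    have hgw := commutator_mem_dimSubgroup e (hM hg) hw
    rw [add_zero] at hgw
    rw [mem_layerComap]
    refine ⟨hgw, ?_⟩
    refine commutator_sub_one_mem_of_bracket_mem e (hM hg)
      (S := Submodule.span (ZMod 2) (Set.range fun j => e (b j) - 1))
      (T := Submodule.span (ZMod 2) (Set.range fun i => e (x i) - 1))
      (Z := (Submodule.span (ZMod 2) (Set.range c)).comap (augSpace e ^ (n + 1 + 2)).mkQ)
      ?_ ?_ ?_ ?_ (hb g hg) (hx (sub_one_mem_augSpace e w))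
    · refine Submodule.span_le.2 ?_
      rintro _ ⟨j, rfl⟩
      exact (mem_dimSubgroup e).1 (hM (hbM j))
    · refine Submodule.span_le.2 ?_
      rintro _ ⟨i, rfl⟩
      exact sub_one_mem_augSpace e _
    · intro y hy
      rw [Submodule.mem_comap, Submodule.mkQ_apply, (Submodule.Quotient.mk_eq_zero _).2 hy]
      exact zero_mem _
    · intro s hs t ht
      refine bracket_mem_of_mem_span (fun j i => ?_) hs ht
      exact Submodule.subset_span ⟨(j, i), rfl⟩
  · rintro _ ⟨g, hg, rfl⟩
    have h1 := mul_self_mem_dimSubgroup e (hM hg)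
    exact dimSubgroup_succ_le_layerComap e le_rfl (dimSubgroup_anti e (Nat.le_succ _)) _
      (dimSubgroup_anti e (show n + 1 + 1 ≤ 2 * n + 1 by omega) h1)

variable {d : ℕ}

local notation "δ" => MonoidAlgebra.of (ZMod 2) (UnivCoxeter d)

lemma exists_two_pow_le_card {n j : ℕ} (hn : 1 ≤ n) (M : Subgroup (UnivCoxeter d))
    (hM : M ≤ dimSubgroup δ n) (hM' : dimSubgroup δ (n + 1) ≤ M)
    (hj : M.relIndex (dimSubgroup δ n) = 2 ^ j) :
    ∃ E : ℕ, coxRank d n ≤ E + j ∧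
      coxRank d (n + 1) + coxRank d n ≤ E + j + d * (coxRank d n - j) ∧
      2 ^ E ≤ Nat.card (M ⧸ (commSq M).subgroupOf M) := by
  have : M.FiniteIndex := ⟨by
    rw [← Subgroup.relIndex_mul_index hM, hj, index_dimSubgroup]
    positivity⟩
  have hfin : (commSq M).relIndex M ≠ 0 :=
    (Nat.card_pos_iff.2 ⟨inferInstance, finite_quotient_commSq M⟩).ne'
  obtain ⟨Z, hZ, hle⟩ := exists_commSq_le_layerComap δ augSpace_le_span_coxGen hn M hM
  set m := Module.finrank (ZMod 2) (layerSpace δ M hM)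
  have hm : m + j = coxRank d n := by
    have h := Subgroup.relIndex_mul_relIndex _ _ _ hM' hM
    rw [relIndex_eq_two_pow δ M hM, hj, relIndex_dimSubgroup, ← pow_add] at h
    exact Nat.pow_right_injective le_rfl h
  set Y := layerComap δ (dimSubgroup δ (n + 1)) le_rfl Z with hYdef
  have hY : Y ≤ dimSubgroup δ (n + 1) := fun g hg => ((mem_layerComap δ).1 hg).1
  have hlayer : layerSpace δ Y hY ≤ Z := fun z hz => by
    obtain ⟨g, hg, rfl⟩ := (mem_layerSpace δ Y hY).1 hz
    exact ((mem_layerComap δ).1 hg).2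
  have ht := (Submodule.finrank_mono hlayer).trans hZ
  set t := Module.finrank (ZMod 2) (layerSpace δ Y hY)
  have h1 : 2 ^ t * Y.relIndex (dimSubgroup δ (n + 1)) = 2 ^ coxRank d (n + 1) := by
    rw [← relIndex_dimSubgroup, ← relIndex_eq_two_pow δ Y hY]
    exact Subgroup.relIndex_mul_relIndex _ _ _ (dimSubgroup_succ_le_layerComap δ le_rfl
      (dimSubgroup_anti δ (by omega)) Z) hY
  obtain ⟨s, -, hs⟩ := (Nat.dvd_prime_pow Nat.prime_two).1 (Dvd.intro_left _ h1)
  rw [hs, ← pow_add] at h1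
  have hts : t + s = coxRank d (n + 1) := Nat.pow_right_injective le_rfl h1
  refine ⟨s + m, by omega, ?_, ?_⟩
  · rw [← hm, Nat.add_sub_cancel]
    omega
  · calc 2 ^ (s + m) = Y.relIndex M := by
          rw [← Subgroup.relIndex_mul_relIndex _ _ _ hY hM', hs, relIndex_eq_two_pow δ M hM,
            pow_add]
      _ ≤ (commSq M).relIndex M := Subgroup.relIndex_le_of_le_left hle hfin

end CommSq

/-- For `d ≥ 3` there is a descending chain `W_d = H_0 ≥ H_1 ≥ ⋯` of normal subgroups of the
universal Coxeter group `W_d` with `|W_d : H_k| = 2^k`, such that for every `ε > 0` and all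
sufficiently large `k`, the rank of the elementary abelian 2-group `H_k/([H_k,W_d]·H_k²)` is
at least `((d−2)/2 − ε)·k`; equivalently, its cardinality is at least
`2^(((d−2)/2 − ε)·k)`. -/
theorem exists_chain_of_normal_subgroups (d : ℕ) (hd : 3 ≤ d) :
    ∃ H : ℕ → Subgroup (UnivCoxeter d),
      H 0 = ⊤ ∧
      (∀ k, H (k + 1) ≤ H k) ∧
      (∀ k, (H k).Normal) ∧
      (∀ k, (H k).index = 2 ^ k) ∧
      ∀ ε : ℝ, 0 < ε → ∃ k₀ : ℕ, ∀ k : ℕ, k₀ ≤ k →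
        (2 : ℝ) ^ ((((d : ℝ) - 2) / 2 - ε) * (k : ℝ)) ≤
          (Nat.card ((H k) ⧸ (commSq (H k)).subgroupOf (H k)) : ℝ) := by
  have hd' : (3 : ℝ) ≤ d := by exact_mod_cast hd
  obtain ⟨n₀, hn₀⟩ := Filter.eventually_atTop.1
    (eventually_mul_coxRank_le d hd (p := 0) (by linarith))
  obtain ⟨H, h0, hle, hidx, hlayer⟩ := exists_chain_of_index_two
    (MonoidAlgebra.of (ZMod 2) (UnivCoxeter d))
    fun m => ⟨max m n₀, le_max_left _ _, (hn₀ _ (le_max_right _ _)).1⟩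
  refine ⟨H, h0, hle, fun k => ?_, hidx, fun ε hε => ?_⟩
  · obtain ⟨n, h1, h2⟩ := hlayer k
    exact normal_of_dimSubgroup_le _ h2 h1
  obtain ⟨k₀, hk₀⟩ := exists_rank_bound d hd hε
  refine ⟨k₀, fun k hk => ?_⟩
  obtain ⟨n, h1, h2⟩ := hlayer k
  have hindex := Subgroup.relIndex_mul_index h2
  rw [hidx] at hindex
  obtain ⟨j, -, hj⟩ := (Nat.dvd_prime_pow Nat.prime_two).1 (Dvd.intro _ hindex)
  rw [hj, index_dimSubgroup, ← pow_add] at hindex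
  have hkj : ∑ i ∈ Finset.range n, coxRank d i + j = k := by
    rw [add_comm]; exact Nat.pow_right_injective le_rfl hindex
  have hjL : j ≤ coxRank d n := by
    have h := Subgroup.relIndex_mul_relIndex _ _ _ h1 h2
    rw [hj, relIndex_dimSubgroup] at h
    exact (Nat.pow_dvd_pow_iff_le_right (by omega)).1 (Dvd.intro_left _ h)
  obtain ⟨hn, hbound⟩ := hk₀ n j hjL (hkj ▸ hk)
  obtain ⟨E, hE1, hE2, hcard⟩ := exists_two_pow_le_card hn (H k) h2 h1 hj
  rw [hkj] at hbound
  have hE := hbound E ?_ ?_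
  · calc (2 : ℝ) ^ ((((d : ℝ) - 2) / 2 - ε) * (k : ℝ)) ≤ (2 : ℝ) ^ (E : ℝ) :=
          Real.rpow_le_rpow_of_exponent_le one_le_two hE
      _ = ((2 ^ E : ℕ) : ℝ) := by rw [Real.rpow_natCast]; push_cast; rfl
      _ ≤ _ := by exact_mod_cast hcard
  · rw [sub_le_iff_le_add]; exact_mod_cast hE1
  · have h : ((coxRank d (n + 1) + coxRank d n : ℕ) : ℝ) ≤
        (E + j + d * (coxRank d n - j) : ℕ) := by exact_mod_cast hE2
    push_cast [Nat.cast_sub hjL] at h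
    linarith
end

section
/- Let r > s > 0 be integers, let V be an r-dimensional vector space over the field F₂ with two elements, and let T be a finite subgroup of GL(V). Let 𝒩 be the set of subspaces W of V of codimension s such that α(W) ≠ W for every α ∈ T with α ≠ 1. Then |𝒩| ≥ C(r,s)₂ · (1 − (|T| − 1)·2^{1 − min{s, r−s}}), where C(r,s)₂ is the Gaussian binomial coefficient. -/
open Finset

/-- The Gaussian binomial coefficient `C(r,s)₂ = ∏_{i=0}^{s−1} (2^{r−i} − 1)/(2^{s−i} − 1)`,
as a real number.  (When `s > r` some factor vanishes, so the value is `0`.) -/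
noncomputable def gaussBinom (r s : ℕ) : ℝ :=
  ∏ i ∈ Finset.range s, (((2 : ℝ) ^ (r - i) - 1) / ((2 : ℝ) ^ (s - i) - 1))

lemma gaussBinom_zero_right (r : ℕ) : gaussBinom r 0 = 1 := by
  simp [gaussBinom]

lemma gaussBinom_nonneg (r s : ℕ) : 0 ≤ gaussBinom r s :=
  Finset.prod_nonneg fun _ _ => div_nonneg
    (sub_nonneg.2 (one_le_pow₀ one_le_two)) (sub_nonneg.2 (one_le_pow₀ one_le_two))

lemma gaussBinom_succ_succ (r s : ℕ) :
    gaussBinom (r + 1) (s + 1) =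
      gaussBinom r s * (((2 : ℝ) ^ (r + 1) - 1) / ((2 : ℝ) ^ (s + 1) - 1)) := by
  rw [gaussBinom, Finset.prod_range_succ']
  simp [gaussBinom]

lemma gaussBinom_mul_two_pow_le (m s : ℕ) :
    gaussBinom (s + m) s * 2 ^ m ≤ gaussBinom (s + m + 1) (s + 1) := by
  rw [gaussBinom_succ_succ]
  refine mul_le_mul_of_nonneg_left ?_ (gaussBinom_nonneg _ _)
  have h : (1 : ℝ) < 2 ^ (s + 1) := one_lt_pow₀ one_lt_two (by simp)
  have h' : (1 : ℝ) ≤ 2 ^ m := one_le_pow₀ one_le_two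
  rw [le_div_iff₀ (by linarith), show s + m + 1 = m + (s + 1) by ring, pow_add (2 : ℝ) m (s + 1)]
  linarith

lemma gaussBinom_mul_two_pow_le_add (n c k : ℕ) :
    gaussBinom n k * 2 ^ (c * k) ≤ gaussBinom (n + c) k := by
  have h : gaussBinom n k * 2 ^ (c * k) =
      ∏ i ∈ Finset.range k, (((2 : ℝ) ^ (n - i) - 1) / ((2 : ℝ) ^ (k - i) - 1) * 2 ^ c) := by
    rw [Finset.prod_mul_distrib, Finset.prod_const, Finset.card_range, ← pow_mul, gaussBinom]
  rw [h, gaussBinom]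
  refine Finset.prod_le_prod (fun i _ => ?_) fun i hi => ?_
  · exact mul_nonneg (div_nonneg (sub_nonneg.2 (one_le_pow₀ one_le_two))
      (sub_nonneg.2 (one_le_pow₀ one_le_two))) (by positivity)
  · rw [div_mul_eq_mul_div]
    refine div_le_div_of_nonneg_right ?_ (sub_nonneg.2 (one_le_pow₀ one_le_two))
    rcases le_total i n with hin | hin
    · rw [show n + c - i = (n - i) + c by omega, pow_add]
      have : (1 : ℝ) ≤ 2 ^ c := one_le_pow₀ one_le_two
      linarith
    · rw [Nat.sub_eq_zero_of_le hin]
      simpa using one_le_pow₀ one_le_two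

lemma sum_card_subtype_comm {A B : Type*} [Fintype A] [Fintype B] (R : A → B → Prop) :
    ∑ a, Nat.card {b // R a b} = ∑ b, Nat.card {a // R a b} := by
  classical
  simp only [Nat.card_eq_fintype_card, Fintype.card_subtype]
  exact Finset.sum_card_bipartiteAbove_eq_sum_card_bipartiteBelow R

section Subspaces

variable {V : Type*} [AddCommGroup V] [Module (ZMod 2) V] [FiniteDimensional (ZMod 2) V]

lemma finrank_comap_mkQ (U : Submodule (ZMod 2) V) (W : Submodule (ZMod 2) (V ⧸ U)) :
    Module.finrank (ZMod 2) (W.comap U.mkQ) =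
      Module.finrank (ZMod 2) W + Module.finrank (ZMod 2) U := by
  have hle : U ≤ W.comap U.mkQ := Submodule.le_comap_mkQ U W
  have e := (Submodule.quotientQuotientEquivQuotient U _ hle).finrank_eq
  rw [Submodule.map_comap_eq_of_surjective U.mkQ_surjective] at e
  have h1 := Submodule.finrank_quotient_add_finrank (W.comap U.mkQ)
  have h2 := Submodule.finrank_quotient_add_finrank W
  have h3 := Submodule.finrank_quotient_add_finrank U
  omega

lemma card_subspaces_ge (U : Submodule (ZMod 2) V) (k : ℕ) :
    Nat.card {W : Submodule (ZMod 2) V //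
        Module.finrank (ZMod 2) W = k + Module.finrank (ZMod 2) U ∧ U ≤ W} =
      Nat.card {W : Submodule (ZMod 2) (V ⧸ U) // Module.finrank (ZMod 2) W = k} := by
  symm
  refine Nat.card_eq_of_bijective (fun W => ⟨W.1.comap U.mkQ, ?_, Submodule.le_comap_mkQ U _⟩)
    ⟨fun W W' h => ?_, fun W => ?_⟩
  · rw [finrank_comap_mkQ, W.2]
  · exact Subtype.ext (Submodule.comap_injective_of_surjective U.mkQ_surjective
      (congrArg Subtype.val h))
  · have hW : (W.1.map U.mkQ).comap U.mkQ = W.1 := by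
      rw [Submodule.comap_map_mkQ, sup_eq_right.2 W.2.2]
    refine ⟨⟨W.1.map U.mkQ, ?_⟩, Subtype.ext hW⟩
    have h := finrank_comap_mkQ U (W.1.map U.mkQ)
    rw [hW, W.2.1] at h
    omega

omit [FiniteDimensional (ZMod 2) V] in
lemma card_subspaces_le (K : Submodule (ZMod 2) V) (k : ℕ) :
    Nat.card {W : Submodule (ZMod 2) V // Module.finrank (ZMod 2) W = k ∧ W ≤ K} =
      Nat.card {W : Submodule (ZMod 2) K // Module.finrank (ZMod 2) W = k} := by
  symm
  refine Nat.card_eq_of_bijective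
    (fun W => ⟨W.1.map K.subtype, ?_, Submodule.map_subtype_le K _⟩)
    ⟨fun W W' h => ?_, fun W => ?_⟩
  · rw [Submodule.finrank_map_subtype_eq, W.2]
  · exact Subtype.ext (Submodule.map_injective_of_injective K.subtype_injective
      (congrArg Subtype.val h))
  · have hW : (W.1.comap K.subtype).map K.subtype = W.1 := by
      rw [Submodule.map_comap_subtype, inf_eq_right.2 W.2.2]
    refine ⟨⟨W.1.comap K.subtype, ?_⟩, Subtype.ext hW⟩
    rw [← Submodule.finrank_map_subtype_eq, hW, W.2.1]

lemma card_eq_two_pow_finrank (M : Type*) [AddCommGroup M] [Module (ZMod 2) M]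
    [FiniteDimensional (ZMod 2) M] :
    Nat.card M = 2 ^ Module.finrank (ZMod 2) M := by
  have := Module.natCard_eq_pow_finrank (K := ZMod 2) (V := M)
  simpa using this

lemma card_mem_and_notMem (W K : Submodule (ZMod 2) V) :
    Nat.card {w : V // w ∈ W ∧ w ∉ K} + 2 ^ Module.finrank (ZMod 2) ↥(W ⊓ K) =
      2 ^ Module.finrank (ZMod 2) W := by
  classical
  have : Finite V := Module.finite_of_finite (ZMod 2)
  have := Fintype.ofFinite V
  rw [← card_eq_two_pow_finrank, ← card_eq_two_pow_finrank]
  have h1 : Nat.card W = Nat.card {w : V // w ∈ W} := rfl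
  have h2 : Nat.card ↥(W ⊓ K) = Nat.card {w : V // w ∈ W ∧ w ∈ K} := rfl
  rw [h1, h2]
  simp only [Nat.card_eq_fintype_card, Fintype.card_subtype, ← Finset.filter_filter]
  rw [add_comm]
  exact Finset.card_filter_add_card_filter_not _

/-- The number of `k`-dimensional subspaces is the Gaussian binomial coefficient. -/
theorem card_subspaces_eq_gaussBinom (k : ℕ) :
    ∀ (V : Type*) [AddCommGroup V] [Module (ZMod 2) V] [FiniteDimensional (ZMod 2) V],
    (Nat.card {W : Submodule (ZMod 2) V // Module.finrank (ZMod 2) W = k} : ℝ) =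
      gaussBinom (Module.finrank (ZMod 2) V) k := by
  induction k with
  | zero =>
    intro V _ _ _
    simp [gaussBinom_zero_right]
  | succ k ih =>
    intro V _ _ _
    classical
    have : Finite V := Module.finite_of_finite (ZMod 2)
    have := Fintype.ofFinite V
    have := Fintype.ofFinite (Submodule (ZMod 2) V)
    have key := sum_card_subtype_comm fun (W : Submodule (ZMod 2) V) (w : V) =>
      Module.finrank (ZMod 2) W = k + 1 ∧ w ∈ W ∧ w ≠ 0
    have hL : ∀ W : Submodule (ZMod 2) V,
        (Nat.card {w : V // Module.finrank (ZMod 2) W = k + 1 ∧ w ∈ W ∧ w ≠ 0} : ℝ) =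
        if Module.finrank (ZMod 2) W = k + 1 then (2 : ℝ) ^ (k + 1) - 1 else 0 := by
      intro W
      split_ifs with h
      · have := card_mem_and_notMem W ⊥
        rw [inf_bot_eq, finrank_bot, pow_zero] at this
        simp only [Submodule.mem_bot] at this
        simp only [h, true_and, ne_eq] at this ⊢
        rw [eq_sub_iff_add_eq]
        exact_mod_cast this
      · simp [h]
    have hR : ∀ w : V,
        (Nat.card {W : Submodule (ZMod 2) V //
          Module.finrank (ZMod 2) W = k + 1 ∧ w ∈ W ∧ w ≠ 0} : ℝ) =
        if w ≠ 0 then gaussBinom (Module.finrank (ZMod 2) V - 1) k else 0 := by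
      intro w
      split_ifs with h
      · have h1 := finrank_span_singleton (K := ZMod 2) h
        have h2 := card_subspaces_ge (Submodule.span (ZMod 2) {w}) k
        have h3 := Submodule.finrank_quotient_add_finrank (Submodule.span (ZMod 2) {w})
        rw [h1] at h2 h3
        simp only [Submodule.span_singleton_le_iff_mem] at h2
        simp only [ne_eq, h, not_false_eq_true, and_true]
        rw [h2, ih, ← h3, Nat.add_sub_cancel]
      · simp [h]
    have key' : (∑ W : Submodule (ZMod 2) V,
        (Nat.card {w : V // Module.finrank (ZMod 2) W = k + 1 ∧ w ∈ W ∧ w ≠ 0} : ℝ)) =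
        ∑ w : V, (Nat.card {W : Submodule (ZMod 2) V //
          Module.finrank (ZMod 2) W = k + 1 ∧ w ∈ W ∧ w ≠ 0} : ℝ) := by
      exact_mod_cast key
    simp only [hL, hR, ← Finset.sum_filter, Finset.sum_const, nsmul_eq_mul] at key'
    rw [Nat.card_eq_fintype_card, Fintype.card_subtype]
    have hc : ((Finset.univ.filter fun w : V => w ≠ 0).card : ℝ) =
        2 ^ Module.finrank (ZMod 2) V - 1 := by
      have := card_mem_and_notMem (⊤ : Submodule (ZMod 2) V) ⊥
      rw [inf_bot_eq, finrank_bot, pow_zero] at this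
      simp only [Submodule.mem_bot, Submodule.mem_top, true_and, finrank_top,
        Nat.card_eq_fintype_card, Fintype.card_subtype] at this
      rw [eq_sub_iff_add_eq]
      exact_mod_cast this
    rw [hc] at key'
    have hpos : (0 : ℝ) < 2 ^ (k + 1) - 1 :=
      sub_pos.2 (one_lt_pow₀ one_lt_two (by simp))
    refine mul_right_cancel₀ hpos.ne' (key'.trans ?_)
    generalize Module.finrank (ZMod 2) V = n
    cases n with
    | zero => simp [gaussBinom]
    | succ n =>
      rw [gaussBinom_succ_succ]
      field_simp
      simp

/-- An injective map `f ≠ 1` leaves at most a proportion `2 ^ (1 - k)` of the `k`-dimensional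
subspaces invariant when `2 * k ≤ dim V`. -/
theorem card_invariant_subspaces_le (f : V →ₗ[ZMod 2] V) (hf : Function.Injective f)
    (hf1 : f ≠ LinearMap.id) (k : ℕ) (hk : 2 * (k + 1) ≤ Module.finrank (ZMod 2) V) :
    (Nat.card {W : Submodule (ZMod 2) V //
      Module.finrank (ZMod 2) W = k + 1 ∧ W ≤ W.comap f} : ℝ) * 2 ^ k ≤
      gaussBinom (Module.finrank (ZMod 2) V) (k + 1) := by
  classical
  have : Finite V := Module.finite_of_finite (ZMod 2)
  have := Fintype.ofFinite V
  have := Fintype.ofFinite (Submodule (ZMod 2) V)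
  set n := Module.finrank (ZMod 2) V with hn
  set K : Submodule (ZMod 2) V := LinearMap.ker (f - LinearMap.id) with hK
  have hmemK : ∀ w, w ∈ K ↔ f w = w := fun w => by
    simp [hK, LinearMap.mem_ker, sub_eq_zero]
  obtain ⟨c, hc⟩ : ∃ c, n = Module.finrank (ZMod 2) K + (c + 1) := by
    have hlt : Module.finrank (ZMod 2) K < n := Submodule.finrank_lt fun h => hf1 <| by
      ext w
      exact (hmemK w).1 (h ▸ Submodule.mem_top)
    exact ⟨n - Module.finrank (ZMod 2) K - 1, by omega⟩
  cases k with
  | zero =>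
    rw [pow_zero, mul_one, zero_add, hn, ← card_subspaces_eq_gaussBinom]
    norm_cast
    exact Nat.card_le_card_of_injective (Subtype.impEmbedding _ _ fun W h => h.1)
      (Subtype.impEmbedding _ _ fun W h => h.1).injective
  | succ k =>
  obtain ⟨m, hm⟩ : ∃ m, n = k + m + 2 := ⟨n - k - 2, by omega⟩
  have hinK : (Nat.card {W : Submodule (ZMod 2) V //
      Module.finrank (ZMod 2) W = k + 1 + 1 ∧ W ≤ K} : ℝ) * 2 ^ ((c + 1) * (k + 2)) ≤
      gaussBinom n (k + 2) := by
    rw [card_subspaces_le, card_subspaces_eq_gaussBinom, hc]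
    exact gaussBinom_mul_two_pow_le_add _ _ _
  have key := sum_card_subtype_comm fun (W : Submodule (ZMod 2) V) (w : V) =>
    Module.finrank (ZMod 2) W = k + 2 ∧ w ∈ W ∧ f w ∈ W ∧ w ∉ K
  have key' : (∑ W : Submodule (ZMod 2) V,
      (Nat.card {w : V // Module.finrank (ZMod 2) W = k + 2 ∧ w ∈ W ∧ f w ∈ W ∧ w ∉ K} : ℝ)) =
      ∑ w : V, (Nat.card {W : Submodule (ZMod 2) V //
        Module.finrank (ZMod 2) W = k + 2 ∧ w ∈ W ∧ f w ∈ W ∧ w ∉ K} : ℝ) := by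
    exact_mod_cast key
  have hR : ∀ w : V,
      (Nat.card {W : Submodule (ZMod 2) V //
        Module.finrank (ZMod 2) W = k + 2 ∧ w ∈ W ∧ f w ∈ W ∧ w ∉ K} : ℝ) =
      if w ∉ K then gaussBinom (k + m) k else 0 := by
    intro w
    by_cases h : w ∉ K
    · rw [if_pos h]
      have hw : w ≠ 0 := fun h0 => h (h0 ▸ K.zero_mem)
      have hli : LinearIndependent (ZMod 2) ![w, f w] := by
        rw [LinearIndependent.pair_iff' hw]
        intro a ha
        have h01 : ∀ a : ZMod 2, a = 0 ∨ a = 1 := by decide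
        rcases h01 a with rfl | rfl
        · rw [zero_smul] at ha
          exact hw (hf (by rw [← ha, map_zero]))
        · rw [one_smul] at ha
          exact h ((hmemK w).2 ha.symm)
      have h1 : Module.finrank (ZMod 2) (Submodule.span (ZMod 2) {w, f w}) = 2 := by
        have := finrank_span_eq_card hli
        rwa [Matrix.range_cons_cons_empty, Fintype.card_fin] at this
      have h2 := card_subspaces_ge (Submodule.span (ZMod 2) {w, f w}) k
      have h3 := Submodule.finrank_quotient_add_finrank (Submodule.span (ZMod 2) {w, f w})
      rw [h1] at h2 h3
      simp only [Submodule.span_le, Set.insert_subset_iff, Set.singleton_subset_iff,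
        SetLike.mem_coe] at h2
      simp only [h, not_false_eq_true, and_true]
      rw [h2, card_subspaces_eq_gaussBinom]
      congr 1
      omega
    · rw [if_neg h]
      simp [h]
  have hL : ∀ W : Submodule (ZMod 2) V,
      (if Module.finrank (ZMod 2) W = k + 2 ∧ W ≤ W.comap f ∧ ¬ W ≤ K then (2 : ℝ) ^ (k + 1)
        else 0) ≤
      (Nat.card {w : V // Module.finrank (ZMod 2) W = k + 2 ∧ w ∈ W ∧ f w ∈ W ∧ w ∉ K} : ℝ) := by
    intro W
    split_ifs with h
    · obtain ⟨h1, h2, h3⟩ := h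
      have hlt : Module.finrank (ZMod 2) ↥(W ⊓ K) < Module.finrank (ZMod 2) W :=
        Submodule.finrank_lt_finrank_of_lt (inf_lt_left.2 h3)
      have h4 := card_mem_and_notMem W K
      have h5 : 2 ^ Module.finrank (ZMod 2) ↥(W ⊓ K) ≤ 2 ^ (k + 1) :=
        Nat.pow_le_pow_right two_pos (by omega)
      have h6 : Nat.card {w : V // Module.finrank (ZMod 2) W = k + 2 ∧ w ∈ W ∧ f w ∈ W ∧ w ∉ K} =
          Nat.card {w : V // w ∈ W ∧ w ∉ K} :=
        Nat.card_congr (Equiv.subtypeEquivRight fun w =>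
          ⟨fun h => ⟨h.2.1, h.2.2.2⟩, fun h => ⟨h1, h.1, h2 h.1, h.2⟩⟩)
      rw [h6]
      rw [h1, pow_succ 2 (k + 1)] at h4
      have : 2 ^ (k + 1) ≤ Nat.card {w : V // w ∈ W ∧ w ∉ K} := by omega
      exact_mod_cast this
    · positivity
  have hsum := (Finset.sum_le_sum fun W (_ : W ∈ Finset.univ) => hL W).trans_eq key'
  simp only [hR, ← Finset.sum_filter, Finset.sum_const, nsmul_eq_mul] at hsum
  have hcK : ((Finset.univ.filter fun w : V => w ∉ K).card : ℝ) * 2 ^ (c + 1) =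
      2 ^ n * (2 ^ (c + 1) - 1) := by
    have h := card_mem_and_notMem (⊤ : Submodule (ZMod 2) V) K
    rw [top_inf_eq] at h
    simp only [Submodule.mem_top, true_and, finrank_top,
      Nat.card_eq_fintype_card, Fintype.card_subtype] at h
    have h' : ((Finset.univ.filter fun w : V => w ∉ K).card : ℝ) +
        2 ^ Module.finrank (ZMod 2) K = 2 ^ n := by exact_mod_cast h
    have h'' : (2 : ℝ) ^ n = 2 ^ Module.finrank (ZMod 2) K * 2 ^ (c + 1) := by
      rw [← pow_add, ← hc]
    linear_combination 2 ^ (c + 1) * h' + h''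
  have hsplit : Nat.card {W : Submodule (ZMod 2) V //
        Module.finrank (ZMod 2) W = k + 1 + 1 ∧ W ≤ W.comap f} ≤
      Nat.card {W : Submodule (ZMod 2) V // Module.finrank (ZMod 2) W = k + 1 + 1 ∧ W ≤ K} +
      (Finset.univ.filter fun W : Submodule (ZMod 2) V =>
        Module.finrank (ZMod 2) W = k + 2 ∧ W ≤ W.comap f ∧ ¬ W ≤ K).card := by
    simp only [Nat.card_eq_fintype_card, Fintype.card_subtype]
    refine (Finset.card_le_card fun W hW => ?_).trans (Finset.card_union_le _ _)
    simp only [Finset.mem_union, Finset.mem_filter, Finset.mem_univ, true_and] at hW ⊢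
    tauto
  have hsplit' : (Nat.card {W : Submodule (ZMod 2) V //
        Module.finrank (ZMod 2) W = k + 1 + 1 ∧ W ≤ W.comap f} : ℝ) ≤
      (Nat.card {W : Submodule (ZMod 2) V //
        Module.finrank (ZMod 2) W = k + 1 + 1 ∧ W ≤ K} : ℝ) +
      ((Finset.univ.filter fun W : Submodule (ZMod 2) V =>
        Module.finrank (ZMod 2) W = k + 2 ∧ W ≤ W.comap f ∧ ¬ W ≤ K).card : ℝ) := by
    exact_mod_cast hsplit
  have hg : gaussBinom (k + m) k * 2 ^ m * 2 ^ m ≤ gaussBinom n (k + 2) := by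
    have h1 := gaussBinom_mul_two_pow_le m k
    have h2 := gaussBinom_mul_two_pow_le m (k + 1)
    rw [show k + 1 + m = k + m + 1 by ring, show k + m + 1 + 1 = n by omega] at h2
    exact (mul_le_mul_of_nonneg_right h1 (by positivity)).trans h2
  set I := (Nat.card {W : Submodule (ZMod 2) V //
        Module.finrank (ZMod 2) W = k + 1 + 1 ∧ W ≤ W.comap f} : ℝ)
  set A := (Nat.card {W : Submodule (ZMod 2) V //
        Module.finrank (ZMod 2) W = k + 1 + 1 ∧ W ≤ K} : ℝ)
  set B := ((Finset.univ.filter fun W : Submodule (ZMod 2) V =>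
        Module.finrank (ZMod 2) W = k + 2 ∧ W ≤ W.comap f ∧ ¬ W ≤ K).card : ℝ)
  set D := ((Finset.univ.filter fun w : V => w ∉ K).card : ℝ)
  set G := gaussBinom n (k + 2)
  set g := gaussBinom (k + m) k
  have hg0 : 0 ≤ g := gaussBinom_nonneg _ _
  have hA : A * 2 ^ (k + 1) * 2 ^ (c + 1) ≤ G := by
    refine le_trans ?_ hinK
    rw [mul_assoc, ← pow_add]
    refine mul_le_mul_of_nonneg_left (pow_le_pow_right₀ one_le_two ?_) (Nat.cast_nonneg _)
    nlinarith
  have hB : B * 2 ^ (k + 1) * 2 ^ (c + 1) ≤ G * (2 ^ (c + 1) - 1) := by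
    have hc1 : (0 : ℝ) ≤ 2 ^ (c + 1) - 1 := sub_nonneg.2 (one_le_pow₀ one_le_two)
    calc B * 2 ^ (k + 1) * 2 ^ (c + 1) ≤ D * g * 2 ^ (c + 1) :=
          mul_le_mul_of_nonneg_right hsum (by positivity)
      _ = g * 2 ^ n * (2 ^ (c + 1) - 1) := by linear_combination g * hcK
      _ ≤ g * 2 ^ (m + m) * (2 ^ (c + 1) - 1) := by
          refine mul_le_mul_of_nonneg_right (mul_le_mul_of_nonneg_left
            (pow_le_pow_right₀ one_le_two ?_) hg0) hc1
          omega
      _ ≤ G * (2 ^ (c + 1) - 1) := by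
          rw [pow_add, ← mul_assoc]
          exact mul_le_mul_of_nonneg_right hg hc1
  have hpos : (0 : ℝ) < 2 ^ (c + 1) := by positivity
  refine le_of_mul_le_mul_right ?_ hpos
  calc I * 2 ^ (k + 1) * 2 ^ (c + 1) ≤ (A + B) * 2 ^ (k + 1) * 2 ^ (c + 1) := by gcongr
    _ ≤ G * 2 ^ (c + 1) := by linarith

lemma finrank_dualAnnihilator (W : Submodule (ZMod 2) V) :
    Module.finrank (ZMod 2) W.dualAnnihilator = Module.finrank (ZMod 2) (V ⧸ W) := by
  have h1 := Subspace.finrank_add_finrank_dualAnnihilator_eq W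
  have h2 := Submodule.finrank_quotient_add_finrank W
  omega

/-- The number of subspaces of codimension `s` is the Gaussian binomial coefficient. -/
theorem card_subspaces_codim_eq_gaussBinom (s : ℕ) :
    (Nat.card {W : Submodule (ZMod 2) V // Module.finrank (ZMod 2) (V ⧸ W) = s} : ℝ) =
      gaussBinom (Module.finrank (ZMod 2) V) s := by
  rw [← Subspace.dual_finrank_eq, ← card_subspaces_eq_gaussBinom]
  norm_cast
  refine Nat.card_eq_of_bijective
    (fun W => ⟨W.1.dualAnnihilator, by rw [finrank_dualAnnihilator, W.2]⟩)
    ⟨fun W W' h => ?_, fun W => ?_⟩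
  · exact Subtype.ext (Subspace.dualAnnihilator_inj.1 (congrArg Subtype.val h))
  · refine ⟨⟨W.1.dualCoannihilator, ?_⟩,
      Subtype.ext Subspace.dualCoannihilator_dualAnnihilator_eq⟩
    rw [← finrank_dualAnnihilator, Subspace.dualCoannihilator_dualAnnihilator_eq, W.2]

theorem card_codim_map_eq_le (α : V ≃ₗ[ZMod 2] V) (hα : α ≠ 1) (s : ℕ) (hs : 0 < s)
    (hsr : s < Module.finrank (ZMod 2) V) :
    (Nat.card {W : Submodule (ZMod 2) V // Module.finrank (ZMod 2) (V ⧸ W) = s ∧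
      W.map (α : V →ₗ[ZMod 2] V) = W} : ℝ) * 2 ^ (min s (Module.finrank (ZMod 2) V - s) - 1) ≤
      gaussBinom (Module.finrank (ZMod 2) V) s := by
  have : Finite V := Module.finite_of_finite (ZMod 2)
  have hid : (α : V →ₗ[ZMod 2] V) ≠ LinearMap.id := fun h => hα <| by
    ext v
    exact LinearMap.congr_fun h v
  rcases le_total s (Module.finrank (ZMod 2) V - s) with h | h
  · rw [min_eq_left h]
    obtain ⟨k, rfl⟩ : ∃ k, s = k + 1 := ⟨s - 1, by omega⟩
    have : Finite (Module.Dual (ZMod 2) V) := Module.finite_of_finite (ZMod 2)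
    have hd := card_invariant_subspaces_le (α : V →ₗ[ZMod 2] V).dualMap
      (LinearMap.dualMap_injective_of_surjective α.surjective) (fun h' => hid <| by
        ext v
        refine (Module.forall_dual_apply_eq_zero_iff (ZMod 2) _).1 ?_ |> sub_eq_zero.1
        intro φ
        have := LinearMap.congr_fun (LinearMap.congr_fun h' φ) v
        simpa [sub_eq_zero] using this) k
      (by rw [Subspace.dual_finrank_eq]; omega)
    rw [Subspace.dual_finrank_eq] at hd
    refine le_trans (mul_le_mul_of_nonneg_right ?_ (by positivity)) hd
    norm_cast
    refine Nat.card_le_card_of_injective (fun W => ⟨W.1.dualAnnihilator, ?_, ?_⟩)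
      fun W W' h => ?_
    · rw [finrank_dualAnnihilator, W.2.1]
    · intro φ hφ
      rw [Submodule.mem_comap, Submodule.mem_dualAnnihilator]
      intro w hw
      exact (Submodule.mem_dualAnnihilator φ).1 hφ _ (W.2.2 ▸ Submodule.mem_map_of_mem hw)
    · exact Subtype.ext (Subspace.dualAnnihilator_inj.1 (congrArg Subtype.val h))
  · rw [min_eq_right h]
    obtain ⟨k, hk⟩ : ∃ k, Module.finrank (ZMod 2) V = s + (k + 1) :=
      ⟨Module.finrank (ZMod 2) V - s - 1, by omega⟩
    have hd := card_invariant_subspaces_le (α : V →ₗ[ZMod 2] V) α.injective hid k (by omega)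
    have hcodim : ∀ W : Submodule (ZMod 2) V,
        Module.finrank (ZMod 2) (V ⧸ W) = s ↔ Module.finrank (ZMod 2) W = k + 1 := fun W => by
      have := Submodule.finrank_quotient_add_finrank W
      omega
    rw [← card_subspaces_eq_gaussBinom] at hd
    rw [← card_subspaces_codim_eq_gaussBinom]
    simp only [hcodim]
    rw [show Module.finrank (ZMod 2) V - s - 1 = k by omega]
    refine le_trans (mul_le_mul_of_nonneg_right ?_ (by positivity)) hd
    norm_cast
    let e := Subtype.impEmbedding
      (fun W : Submodule (ZMod 2) V => Module.finrank (ZMod 2) W = k + 1 ∧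
        W.map (α : V →ₗ[ZMod 2] V) = W)
      (fun W => Module.finrank (ZMod 2) W = k + 1 ∧ W ≤ W.comap (α : V →ₗ[ZMod 2] V))
      fun W h => ⟨h.1, Submodule.map_le_iff_le_comap.1 h.2.le⟩
    exact Nat.card_le_card_of_injective e e.injective

end Subspaces

/-- If `V` is an `r`-dimensional vector space over `F₂`, `T` is a finite subgroup of `GL(V)`,
and `𝒩` is the set of subspaces `W` of codimension `s` with `α(W) ≠ W` for every
`α ∈ T ∖ {1}`, then `|𝒩| ≥ C(r,s)₂·(1 − (|T| − 1)·2^{1 − min{s, r−s}})`. -/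
theorem card_moved_subspaces_lower_bound
    (r s : ℕ) (hs : 0 < s) (hrs : s < r)
    (V : Type*) [AddCommGroup V] [Module (ZMod 2) V] [FiniteDimensional (ZMod 2) V]
    (hV : Module.finrank (ZMod 2) V = r)
    (T : Subgroup (V ≃ₗ[ZMod 2] V)) [Finite T] :
    gaussBinom r s *
        (1 - ((Nat.card T : ℝ) - 1) * (2 : ℝ) ^ (1 - ((min s (r - s) : ℕ) : ℝ))) ≤
      (Nat.card {W : Submodule (ZMod 2) V //
          Module.finrank (ZMod 2) (V ⧸ W) = s ∧
          ∀ α ∈ T, α ≠ 1 → Submodule.map (α : V →ₗ[ZMod 2] V) W ≠ W} : ℝ) := by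
  classical
  subst hV
  have : Finite V := Module.finite_of_finite (ZMod 2)
  have := Fintype.ofFinite V
  have := Fintype.ofFinite (Submodule (ZMod 2) V)
  have := Fintype.ofFinite T
  set r := Module.finrank (ZMod 2) V
  set inv : (V ≃ₗ[ZMod 2] V) → Finset (Submodule (ZMod 2) V) := fun α =>
    Finset.univ.filter fun W => Module.finrank (ZMod 2) (V ⧸ W) = s ∧
      W.map (α : V →ₗ[ZMod 2] V) = W with hinv
  set p : ℝ := (2 : ℝ) ^ (1 - ((min s (r - s) : ℕ) : ℝ)) with hp
  have hp_mul : p * 2 ^ (min s (r - s) - 1) = 1 := by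
    have h1 : 1 ≤ min s (r - s) := by omega
    rw [hp, ← Real.rpow_natCast, ← Real.rpow_add two_pos, Nat.cast_sub h1]
    simp
  have hone : ∀ α : V ≃ₗ[ZMod 2] V, α ≠ 1 → ((inv α).card : ℝ) ≤ gaussBinom r s * p := by
    intro α hα
    have h := card_codim_map_eq_le α hα s hs hrs
    rw [Nat.card_eq_fintype_card, Fintype.card_subtype] at h
    have h2 : (0 : ℝ) < 2 ^ (min s (r - s) - 1) := by positivity
    refine le_of_mul_le_mul_right ?_ h2
    rw [mul_assoc, hp_mul, mul_one]
    exact h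
  rw [Nat.card_eq_fintype_card (α := {W : Submodule (ZMod 2) V // _}), Fintype.card_subtype]
  set N := Finset.univ.filter fun W : Submodule (ZMod 2) V =>
    Module.finrank (ZMod 2) (V ⧸ W) = s ∧
      ∀ α ∈ T, α ≠ 1 → Submodule.map (α : V →ₗ[ZMod 2] V) W ≠ W
  have hall := card_subspaces_codim_eq_gaussBinom (V := V) s
  rw [Nat.card_eq_fintype_card, Fintype.card_subtype] at hall
  have hcover : (Finset.univ.filter fun W : Submodule (ZMod 2) V =>
      Module.finrank (ZMod 2) (V ⧸ W) = s) ⊆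
      N ∪ (Finset.univ.erase (1 : T)).biUnion fun α => inv α := by
    intro W hW
    simp only [Finset.mem_filter, Finset.mem_univ, true_and] at hW
    by_cases hN : W ∈ N
    · exact Finset.mem_union_left _ hN
    · simp only [N, Finset.mem_filter, Finset.mem_univ, true_and, hW, not_forall, not_not] at hN
      obtain ⟨α, hαT, hα, hαW⟩ := hN
      refine Finset.mem_union_right _ (Finset.mem_biUnion.2 ⟨⟨α, hαT⟩, ?_, ?_⟩)
      · exact Finset.mem_erase.2 ⟨fun h => hα (congrArg Subtype.val h), Finset.mem_univ _⟩
      · simp [hinv, hW, hαW]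
  have hcard := (Finset.card_le_card hcover).trans ((Finset.card_union_le _ _).trans
    (Nat.add_le_add_left Finset.card_biUnion_le _))
  have hcard' : gaussBinom r s ≤
      (N.card : ℝ) + ∑ α ∈ Finset.univ.erase (1 : T), ((inv α).card : ℝ) := by
    rw [← hall]
    exact_mod_cast hcard
  have hsum : ∑ α ∈ Finset.univ.erase (1 : T), ((inv α).card : ℝ) ≤
      ((Nat.card T : ℝ) - 1) * (gaussBinom r s * p) := by
    have hle : ∀ α ∈ Finset.univ.erase (1 : T), ((inv α).card : ℝ) ≤ gaussBinom r s * p :=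
      fun α hα => hone α (by simpa using hα)
    refine (Finset.sum_le_card_nsmul _ _ _ hle).trans_eq ?_
    rw [Finset.card_erase_of_mem (Finset.mem_univ _), nsmul_eq_mul, Finset.card_univ,
      ← Nat.card_eq_fintype_card, Nat.cast_sub Nat.card_pos, Nat.cast_one]
  linarith
end

section
/- Let r > s > 0 be integers, let V be an r-dimensional vector space over F₂, and let α ∈ GL(V) be an involution (α² = 1, α ≠ 1). Let t be the dimension of the image of α − 1 (the number of Jordan blocks of α of size 2), so 1 ≤ t and 2t ≤ r, and let C = ker(α − 1). Then the number of α-invariant subspaces W of V of codimension s equals the sum over all integers x with max{0, t−s} ≤ x ≤ min{t, ⌊(r−s)/2⌋} of C(t, x)₂ · C(r−t−x, r−s−2x)₂ · 2^{(s−t+x)·x}, where C(a,b)₂ denotes the Gaussian binomial coefficient (taken to be 0 if b > a or b < 0). -/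
open Finset

section FiberCounting

theorem Nat.card_subtype_eq_mul_of_card_fiber {A B R : Type*} [Finite A] [Finite B] [Semiring R]
    {p : A → Prop} {q : B → Prop} (f : A → B) (m : R) (hf : ∀ a, p a → q (f a))
    (hm : ∀ b, q b → (Nat.card {a // p a ∧ f a = b} : R) = m) :
    (Nat.card {a // p a} : R) = Nat.card {b // q b} * m := by
  classical
  have := Fintype.ofFinite A
  have := Fintype.ofFinite B
  simp only [Nat.card_eq_fintype_card, Fintype.card_subtype] at hm ⊢
  rw [Finset.card_eq_sum_card_fiberwise (f := f) (t := Finset.univ.filter q)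
    (fun a ha => by simpa using hf a (by simpa using ha)), Nat.cast_sum]
  rw [Finset.sum_congr rfl (g := fun _ => m), Finset.sum_const, nsmul_eq_mul]
  intro b hb
  rw [Finset.filter_filter]
  exact hm b (by simpa using hb)

theorem Nat.card_subtype_eq_sum_card_fiber {A B : Type*} [Finite A]
    {p : A → Prop} (f : A → B) (t : Finset B) (hf : ∀ a, p a → f a ∈ t) :
    Nat.card {a // p a} = ∑ b ∈ t, Nat.card {a // p a ∧ f a = b} := by
  classical
  have := Fintype.ofFinite A
  simp only [Nat.card_eq_fintype_card, Fintype.card_subtype]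
  rw [Finset.card_eq_sum_card_fiberwise (f := f) (t := t)
    (fun a ha => by simpa using hf a (by simpa using ha))]
  simp only [Finset.filter_filter]

end FiberCounting

section SubspaceCounting

variable {K V U : Type*} [Field K] [AddCommGroup V] [Module K V] [AddCommGroup U] [Module K U]

theorem Submodule.finrank_map_add_finrank_inf_ker [FiniteDimensional K V] (f : V →ₗ[K] U)
    (W : Submodule K V) :
    Module.finrank K (W.map f) + Module.finrank K (W ⊓ LinearMap.ker f : Submodule K V) =
      Module.finrank K W := by
  rw [← LinearMap.finrank_range_add_finrank_ker (f.domRestrict W), LinearMap.range_domRestrict,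
    LinearMap.ker_domRestrict, ← Submodule.finrank_map_subtype_eq W, Submodule.map_comap_subtype]

theorem Submodule.card_projections [FiniteDimensional K V] (p : Submodule K V) :
    Nat.card {f : V →ₗ[K] p // ∀ x : p, f x = x} =
      Nat.card K ^ (Module.finrank K (V ⧸ p) * Module.finrank K p) := by
  obtain ⟨f₀, hf₀⟩ := p.subtype.exists_leftInverse_of_injective p.ker_subtype
  replace hf₀ : ∀ x : p, f₀ x = x := fun x => LinearMap.congr_fun hf₀ x
  let e : ((V ⧸ p) →ₗ[K] p) ≃ {f : V →ₗ[K] p // ∀ x : p, f x = x} :=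
    { toFun := fun g => ⟨f₀ + g ∘ₗ p.mkQ, fun x => by
        simp [hf₀, (Submodule.Quotient.mk_eq_zero p).2 x.2]⟩
      invFun := fun f => p.liftQ (f.1 - f₀) fun x hx => by
        have h₁ := f.2 ⟨x, hx⟩
        have h₂ := hf₀ ⟨x, hx⟩
        simp_all
      left_inv := fun g => by
        ext x
        simp
      right_inv := fun f => by
        ext x
        simp }
  rw [← Nat.card_congr e, Module.natCard_eq_pow_finrank (K := K), Module.finrank_linearMap]

theorem Submodule.card_isCompl [FiniteDimensional K V] (p : Submodule K V) :
    Nat.card {q : Submodule K V // IsCompl p q} =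
      Nat.card K ^ (Module.finrank K (V ⧸ p) * Module.finrank K p) := by
  rw [Nat.card_congr p.isComplEquivProj, p.card_projections]

/-- The subspace between `A` and `B` corresponding to a subspace of `B ⧸ A`. -/
def Submodule.ofSubquotient (A B : Submodule K V) (Q : Submodule K (B ⧸ A.comap B.subtype)) :
    Submodule K V :=
  (Q.comap (A.comap B.subtype).mkQ).map B.subtype

namespace Submodule

variable {A B : Submodule K V}

theorem ofSubquotient_injective : Function.Injective (ofSubquotient A B) :=
  (map_injective_of_injective B.injective_subtype).comp
    (comap_injective_of_surjective (mkQ_surjective _))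

theorem ofSubquotient_inf (P Q : Submodule K (B ⧸ A.comap B.subtype)) :
    ofSubquotient A B (P ⊓ Q) = ofSubquotient A B P ⊓ ofSubquotient A B Q := by
  rw [ofSubquotient, comap_inf, map_inf _ B.injective_subtype, ofSubquotient, ofSubquotient]

theorem ofSubquotient_sup (P Q : Submodule K (B ⧸ A.comap B.subtype)) :
    ofSubquotient A B (P ⊔ Q) = ofSubquotient A B P ⊔ ofSubquotient A B Q := by
  rw [ofSubquotient, ofSubquotient, ofSubquotient, ← map_sup]
  exact congrArg (map B.subtype)
    (congrArg Subtype.val (OrderIso.map_sup (comapMkQRelIso (A.comap B.subtype)) P Q))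

theorem ofSubquotient_top : ofSubquotient A B ⊤ = B := by
  simp [ofSubquotient]

theorem ofSubquotient_bot (h : A ≤ B) : ofSubquotient A B ⊥ = A := by
  simpa [ofSubquotient, map_comap_subtype] using h

theorem exists_ofSubquotient_eq {W : Submodule K V} (hA : A ≤ W) (hB : W ≤ B) :
    ∃ Q, ofSubquotient A B Q = W := by
  refine ⟨(W.comap B.subtype).map (A.comap B.subtype).mkQ, ?_⟩
  rw [ofSubquotient, comap_map_mkQ, sup_eq_right.2 (comap_mono hA), map_comap_subtype,
    inf_eq_right.2 hB]

theorem le_ofSubquotient (h : A ≤ B) (Q : Submodule K (B ⧸ A.comap B.subtype)) :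
    A ≤ ofSubquotient A B Q := by
  conv_lhs => rw [← ofSubquotient_bot h]
  exact map_mono (comap_mono bot_le)

theorem ofSubquotient_le (Q : Submodule K (B ⧸ A.comap B.subtype)) :
    ofSubquotient A B Q ≤ B :=
  map_subtype_le _ _

theorem finrank_subquotient_add [FiniteDimensional K V] (h : A ≤ B) :
    Module.finrank K (B ⧸ A.comap B.subtype) + Module.finrank K A = Module.finrank K B := by
  rw [← finrank_quotient_add_finrank (A.comap B.subtype),
    (comapSubtypeEquivOfLe h).finrank_eq]

theorem finrank_ofSubquotient [FiniteDimensional K V] (h : A ≤ B)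
    (Q : Submodule K (B ⧸ A.comap B.subtype)) :
    Module.finrank K (ofSubquotient A B Q) = Module.finrank K Q + Module.finrank K A := by
  rw [ofSubquotient, finrank_map_subtype_eq, ← finrank_map_add_finrank_inf_ker (mkQ _),
    map_comap_eq_of_surjective (mkQ_surjective _), ker_mkQ, inf_eq_right.2 (le_comap_mkQ _ _),
    (comapSubtypeEquivOfLe h).finrank_eq]

theorem card_relative_compl [FiniteDimensional K V] {A C B : Submodule K V} (hAC : A ≤ C)
    (hCB : C ≤ B) :
    Nat.card {W : Submodule K V // W ⊓ C = A ∧ W ⊔ C = B} =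
      Nat.card K ^ ((Module.finrank K B - Module.finrank K C) *
        (Module.finrank K C - Module.finrank K A)) := by
  have hAB := hAC.trans hCB
  obtain ⟨P, rfl⟩ := exists_ofSubquotient_eq hAC hCB
  have e : {Q // IsCompl P Q} ≃
      {W : Submodule K V // W ⊓ ofSubquotient A B P = A ∧ W ⊔ ofSubquotient A B P = B} := by
    refine Equiv.ofBijective (fun Q => ⟨ofSubquotient A B Q.1, ?_, ?_⟩) ⟨?_, ?_⟩
    · rw [← ofSubquotient_inf, Q.2.symm.inf_eq_bot, ofSubquotient_bot hAB]
    · rw [← ofSubquotient_sup, Q.2.symm.sup_eq_top, ofSubquotient_top]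
    · intro Q Q' h
      exact Subtype.ext (ofSubquotient_injective (congrArg Subtype.val h))
    · rintro ⟨W, h₁, h₂⟩
      obtain ⟨Q, rfl⟩ := exists_ofSubquotient_eq (h₁.ge.trans inf_le_left)
        (le_sup_left.trans h₂.le)
      refine ⟨⟨Q, IsCompl.symm (IsCompl.of_eq ?_ ?_)⟩, rfl⟩ <;> apply ofSubquotient_injective
      · rw [ofSubquotient_inf, h₁, ofSubquotient_bot hAB]
      · rw [ofSubquotient_sup, h₂, ofSubquotient_top]
  rw [← Nat.card_congr e, card_isCompl]
  have h₁ := finrank_quotient_add_finrank P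
  have h₂ := finrank_ofSubquotient hAB P
  have h₃ := finrank_subquotient_add hAB
  congr 2 <;> omega

theorem card_interval_finrank [FiniteDimensional K V] (h : A ≤ B) (k : ℕ) :
    Nat.card {W : Submodule K V // (A ≤ W ∧ W ≤ B) ∧ Module.finrank K W = k + Module.finrank K A} =
      Nat.card {Q : Submodule K (B ⧸ A.comap B.subtype) // Module.finrank K Q = k} := by
  symm
  refine Nat.card_congr (Equiv.ofBijective (fun Q => ⟨ofSubquotient A B Q.1,
    ⟨le_ofSubquotient h _, ofSubquotient_le _⟩, ?_⟩) ⟨?_, ?_⟩)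
  · rw [finrank_ofSubquotient h, Q.2]
  · intro Q Q' h
    exact Subtype.ext (ofSubquotient_injective (congrArg Subtype.val h))
  · rintro ⟨W, ⟨h₁, h₂⟩, h₃⟩
    obtain ⟨Q, rfl⟩ := exists_ofSubquotient_eq h₁ h₂
    rw [finrank_ofSubquotient h] at h₃
    exact ⟨⟨Q, by omega⟩, rfl⟩

theorem card_finrank_eq_mul [Finite K] [FiniteDimensional K V] {k : ℕ}
    (hk : k ≤ Module.finrank K V) :
    ∏ i : Fin k, (Nat.card K ^ Module.finrank K V - Nat.card K ^ i.val) =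
      Nat.card {W : Submodule K V // Module.finrank K W = k} *
        ∏ i : Fin k, (Nat.card K ^ k - Nat.card K ^ i.val) := by
  have := Fintype.ofFinite K
  have : Finite V := Module.finite_of_finite K
  rw [Nat.card_eq_fintype_card (α := K), ← card_linearIndependent hk]
  refine Nat.card_subtype_eq_mul_of_card_fiber (fun s => span K (Set.range s)) _
    (fun s hs => by rw [finrank_span_eq_card hs, Fintype.card_fin]) fun W hW => ?_
  rw [← hW, ← card_linearIndependent le_rfl]
  subst hW
  symm
  refine Nat.card_congr (Equiv.ofBijective (fun s => ⟨fun i => (s.1 i : V), ?_, ?_⟩) ⟨?_, ?_⟩)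
  · exact s.2.map' W.subtype W.ker_subtype
  · have h : span K (Set.range s.1) = ⊤ := s.2.span_eq_top_of_card_eq_finrank' (by simp)
    have := congrArg (map W.subtype) h
    rw [map_span, ← Set.range_comp, map_subtype_top] at this
    exact this
  · intro s s' h
    ext i
    exact congrFun (congrArg Subtype.val h) i
  · rintro ⟨s, hs, hW⟩
    refine ⟨⟨fun i => ⟨s i, hW ▸ subset_span ⟨i, rfl⟩⟩, ?_⟩, rfl⟩
    exact LinearIndependent.of_comp W.subtype hs

end Submodule

end SubspaceCounting

theorem Submodule.card_finrank_eq_gaussBinom {V : Type*} [AddCommGroup V] [Module (ZMod 2) V]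
    [FiniteDimensional (ZMod 2) V] (k : ℕ) :
    (Nat.card {W : Submodule (ZMod 2) V // Module.finrank (ZMod 2) W = k} : ℝ) =
      gaussBinom (Module.finrank (ZMod 2) V) k := by
  obtain hk | hk := le_or_gt k (Module.finrank (ZMod 2) V)
  · have h := congrArg (Nat.cast : ℕ → ℝ) (card_finrank_eq_mul (K := ZMod 2) hk)
    have hcast : ∀ n, k ≤ n → ((∏ i : Fin k, (Nat.card (ZMod 2) ^ n -
        Nat.card (ZMod 2) ^ i.val) : ℕ) : ℝ) =
        (∏ i ∈ Finset.range k, (2 : ℝ) ^ i) * ∏ i ∈ Finset.range k, ((2 : ℝ) ^ (n - i) - 1) := by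
      intro n hn
      rw [Fin.prod_univ_eq_prod_range (fun i => Nat.card (ZMod 2) ^ n - Nat.card (ZMod 2) ^ i) k,
        Nat.cast_prod, ← Finset.prod_mul_distrib]
      refine Finset.prod_congr rfl fun i hi => ?_
      have hi' : i ≤ n := (Finset.mem_range.1 hi).le.trans hn
      rw [Nat.card_zmod, Nat.cast_sub (Nat.pow_le_pow_right two_pos hi'), mul_sub, ← pow_add,
        Nat.add_sub_cancel' hi']
      simp
    rw [Nat.cast_mul, hcast _ hk, hcast _ le_rfl] at h
    rw [gaussBinom, Finset.prod_div_distrib, eq_div_iff]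
    · have h2 : (∏ i ∈ Finset.range k, (2 : ℝ) ^ i) ≠ 0 :=
        Finset.prod_ne_zero_iff.2 fun i _ => by positivity
      apply mul_left_cancel₀ h2
      rw [h]
      ring
    · refine Finset.prod_ne_zero_iff.2 fun i hi => ?_
      have : (1 : ℝ) < 2 ^ (k - i) :=
        one_lt_pow₀ one_lt_two (Nat.sub_pos_of_lt (Finset.mem_range.1 hi)).ne'
      linarith
  · have : IsEmpty {W : Submodule (ZMod 2) V // Module.finrank (ZMod 2) W = k} :=
      ⟨fun W => (hk.trans_eq W.2.symm).not_ge W.1.finrank_le⟩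
    rw [Nat.card_of_isEmpty, gaussBinom, Finset.prod_eq_zero (Finset.mem_range.2 hk)] <;> simp

namespace Submodule

variable {V : Type*} [AddCommGroup V] [Module (ZMod 2) V] [FiniteDimensional (ZMod 2) V]

theorem card_interval_finrank_eq_gaussBinom {A B : Submodule (ZMod 2) V} (h : A ≤ B) (k : ℕ) :
    (Nat.card {W : Submodule (ZMod 2) V // (A ≤ W ∧ W ≤ B) ∧
      Module.finrank (ZMod 2) W = k + Module.finrank (ZMod 2) A} : ℝ) =
      gaussBinom (Module.finrank (ZMod 2) B - Module.finrank (ZMod 2) A) k := by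
  rw [card_interval_finrank h, card_finrank_eq_gaussBinom, ← finrank_subquotient_add h,
    Nat.add_sub_cancel]

theorem card_le_finrank_eq_gaussBinom (B : Submodule (ZMod 2) V) (k : ℕ) :
    (Nat.card {W : Submodule (ZMod 2) V // W ≤ B ∧ Module.finrank (ZMod 2) W = k} : ℝ) =
      gaussBinom (Module.finrank (ZMod 2) B) k := by
  simpa using card_interval_finrank_eq_gaussBinom (bot_le : ⊥ ≤ B) k

variable (N : V →ₗ[ZMod 2] V)

/-- Subspaces `W` of dimension `d` stable under a square-zero `N`, with prescribed image `X`. -/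
theorem card_stable_with_image (hN : LinearMap.range N ≤ LinearMap.ker N) {d : ℕ}
    {X : Submodule (ZMod 2) V} (hX : X ≤ LinearMap.range N)
    (hd : 2 * Module.finrank (ZMod 2) X ≤ d) :
    (Nat.card {W : Submodule (ZMod 2) V //
        (Module.finrank (ZMod 2) W = d ∧ W.map N ≤ W) ∧ W.map N = X} : ℝ) =
      gaussBinom (Module.finrank (ZMod 2) (LinearMap.ker N) - Module.finrank (ZMod 2) X)
          (d - 2 * Module.finrank (ZMod 2) X) *
        2 ^ (Module.finrank (ZMod 2) X * (Module.finrank (ZMod 2) (LinearMap.ker N) -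
          (d - Module.finrank (ZMod 2) X))) := by
  have : Finite V := Module.finite_of_finite (ZMod 2)
  have hXC : X ≤ LinearMap.ker N := hX.trans hN
  have hCP : LinearMap.ker N ≤ X.comap N := LinearMap.ker_le_comap N
  have hmap : (X.comap N).map N = X := by rw [map_comap_eq, inf_eq_right.2 hX]
  rw [← card_interval_finrank_eq_gaussBinom hXC]
  refine Nat.card_subtype_eq_mul_of_card_fiber (fun W => W ⊓ LinearMap.ker N) _ ?_ ?_
  · rintro W ⟨⟨hWd, hWN⟩, rfl⟩
    have := finrank_map_add_finrank_inf_ker N W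
    exact ⟨⟨le_inf hWN hXC, inf_le_right⟩, by omega⟩
  · rintro Y ⟨⟨hXY, hYC⟩, hYd⟩
    have key : ∀ W : Submodule (ZMod 2) V,
        (((Module.finrank (ZMod 2) W = d ∧ W.map N ≤ W) ∧ W.map N = X) ∧
          W ⊓ LinearMap.ker N = Y) ↔
        (W ⊓ LinearMap.ker N = Y ∧ W ⊔ LinearMap.ker N = X.comap N) := by
      intro W
      have hdim := finrank_map_add_finrank_inf_ker N W
      rw [← comap_map_eq]
      constructor
      · rintro ⟨⟨-, rfl⟩, rfl⟩
        exact ⟨rfl, rfl⟩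
      · rintro ⟨rfl, h⟩
        have hWX : W.map N = X := by
          rw [← hmap, ← h, map_comap_eq, inf_eq_right.2 (LinearMap.map_le_range)]
        rw [hWX] at hdim ⊢
        exact ⟨⟨⟨by omega, hXY.trans inf_le_left⟩, rfl⟩, rfl⟩
    have hP := finrank_map_add_finrank_inf_ker N (X.comap N)
    rw [hmap, inf_eq_right.2 hCP] at hP
    rw [Nat.card_congr (Equiv.subtypeEquivRight key), card_relative_compl hYC hCP, Nat.card_zmod,
      ← hP, Nat.add_sub_cancel, hYd, Nat.cast_pow, Nat.cast_ofNat]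
    congr 3
    omega

theorem card_stable_of_range_le_ker (hN : LinearMap.range N ≤ LinearMap.ker N) (d : ℕ) :
    (Nat.card {W : Submodule (ZMod 2) V //
        Module.finrank (ZMod 2) W = d ∧ W.map N ≤ W} : ℝ) =
      ∑ x ∈ Finset.Icc (d - Module.finrank (ZMod 2) (LinearMap.ker N))
          (min (Module.finrank (ZMod 2) (LinearMap.range N)) (d / 2)),
        gaussBinom (Module.finrank (ZMod 2) (LinearMap.range N)) x *
          (gaussBinom (Module.finrank (ZMod 2) (LinearMap.ker N) - x) (d - 2 * x) *
          2 ^ (x * (Module.finrank (ZMod 2) (LinearMap.ker N) - (d - x)))) := by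
  have : Finite V := Module.finite_of_finite (ZMod 2)
  rw [Nat.card_subtype_eq_sum_card_fiber (fun W => Module.finrank (ZMod 2) (W.map N)),
    Nat.cast_sum]
  · refine Finset.sum_congr rfl fun x hx => ?_
    rw [← card_le_finrank_eq_gaussBinom]
    refine Nat.card_subtype_eq_mul_of_card_fiber (fun W => W.map N) _
      (fun W hW => ⟨LinearMap.map_le_range, hW.2⟩) ?_
    rintro X ⟨hX, rfl⟩
    rw [← card_stable_with_image N hN hX (by rw [Finset.mem_Icc] at hx; omega)]
    congr 1
    refine Nat.card_congr (Equiv.subtypeEquivRight fun W => ?_)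
    constructor
    · exact fun h => ⟨h.1.1, h.2⟩
    · exact fun h => ⟨⟨h.1, by rw [h.2]⟩, h.2⟩
  · rintro W ⟨hWd, hWN⟩
    have h₁ := finrank_map_add_finrank_inf_ker N W
    have h₂ : Module.finrank (ZMod 2) (W.map N) ≤
        Module.finrank (ZMod 2) (W ⊓ LinearMap.ker N : Submodule (ZMod 2) V) :=
      finrank_mono (le_inf hWN (LinearMap.map_le_range.trans hN))
    have h₃ : Module.finrank (ZMod 2) (W ⊓ LinearMap.ker N : Submodule (ZMod 2) V) ≤
        Module.finrank (ZMod 2) (LinearMap.ker N) := finrank_mono inf_le_right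
    have h₄ : Module.finrank (ZMod 2) (W.map N) ≤ Module.finrank (ZMod 2) (LinearMap.range N) :=
      finrank_mono LinearMap.map_le_range
    rw [Finset.mem_Icc]
    omega

theorem map_eq_self_iff_map_sub_id_le {K V : Type*} [Field K] [AddCommGroup V] [Module K V]
    [FiniteDimensional K V] (α : V ≃ₗ[K] V) (W : Submodule K V) :
    W.map (α : V →ₗ[K] V) = W ↔ W.map ((α : V →ₗ[K] V) - LinearMap.id) ≤ W := by
  have : W.map (α : V →ₗ[K] V) = W ↔ W.map (α : V →ₗ[K] V) ≤ W :=
    ⟨le_of_eq, fun h => eq_of_le_of_finrank_eq h (α.finrank_map_eq W)⟩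
  rw [this, map_le_iff_le_comap, map_le_iff_le_comap]
  refine forall₂_congr fun w hw => ?_
  simp [W.sub_mem_iff_left hw]

end Submodule

theorem LinearEquiv.range_sub_id_le_ker_of_mul_self {V : Type*} [AddCommGroup V]
    [Module (ZMod 2) V] (α : V ≃ₗ[ZMod 2] V) (hα : α * α = 1) :
    LinearMap.range ((α : V →ₗ[ZMod 2] V) - LinearMap.id) ≤
      LinearMap.ker ((α : V →ₗ[ZMod 2] V) - LinearMap.id) := by
  rintro _ ⟨v, rfl⟩
  have h : α (α v) = v := LinearEquiv.congr_fun hα v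
  have h₂ : v + v = 0 := ZModModule.add_self v
  have h₃ : α v + α v = 0 := ZModModule.add_self (α v)
  simp only [LinearMap.mem_ker, LinearMap.sub_apply, LinearMap.id_apply, LinearEquiv.coe_coe,
    map_sub, h]
  rw [show v - α v - (α v - v) = (v + v) - (α v + α v) by abel, h₂, h₃, sub_zero]

/-- Let `V` be an `r`-dimensional vector space over `F₂` and let `α ∈ GL(V)` be an involution
with `t` Jordan blocks of size 2 (i.e. `t = dim im(α − 1)`), so `1 ≤ t` and `2t ≤ r`.  Then
the number of `α`-invariant subspaces of codimension `s` equals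
`∑_{x = max{0, t−s}}^{min{t, ⌊(r−s)/2⌋}} C(t,x)₂ · C(r−t−x, r−s−2x)₂ · 2^{(s−t+x)·x}`.
(In `ℕ`, `t - s` is truncated subtraction, i.e. `max{0, t−s}`, and `s + x - t = s − t + x`
since `x ≥ t − s`.) -/
theorem card_fixed_subspaces_of_involution
    (r s : ℕ) (hs : 0 < s) (hrs : s < r)
    (V : Type*) [AddCommGroup V] [Module (ZMod 2) V] [FiniteDimensional (ZMod 2) V]
    (hV : Module.finrank (ZMod 2) V = r)
    (α : V ≃ₗ[ZMod 2] V) (hα1 : α ≠ 1) (hα2 : α * α = 1)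
    (t : ℕ)
    (ht : t = Module.finrank (ZMod 2)
        (LinearMap.range ((α : V →ₗ[ZMod 2] V) - LinearMap.id)))
    (ht1 : 1 ≤ t) (ht2 : 2 * t ≤ r) :
    (Nat.card {W : Submodule (ZMod 2) V //
        Module.finrank (ZMod 2) (V ⧸ W) = s ∧
        Submodule.map (α : V →ₗ[ZMod 2] V) W = W} : ℝ) =
      ∑ x ∈ Finset.Icc (t - s) (min t ((r - s) / 2)),
        gaussBinom t x * gaussBinom (r - t - x) (r - s - 2 * x) *
          (2 : ℝ) ^ ((s + x - t) * x) := by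
  have hN := α.range_sub_id_le_ker_of_mul_self hα2
  have hker := LinearMap.finrank_range_add_finrank_ker ((α : V →ₗ[ZMod 2] V) - LinearMap.id)
  have key : ∀ W : Submodule (ZMod 2) V,
      (Module.finrank (ZMod 2) (V ⧸ W) = s ∧ W.map (α : V →ₗ[ZMod 2] V) = W) ↔
      (Module.finrank (ZMod 2) W = r - s ∧
        W.map ((α : V →ₗ[ZMod 2] V) - LinearMap.id) ≤ W) := by
    intro W
    have := W.finrank_quotient_add_finrank
    rw [Submodule.map_eq_self_iff_map_sub_id_le]
    exact and_congr_left fun _ => by omega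
  rw [Nat.card_congr (Equiv.subtypeEquivRight key),
    Submodule.card_stable_of_range_le_ker _ hN, ← ht]
  rw [← ht, hV] at hker
  refine Finset.sum_congr (by congr 1; omega) fun x hx => ?_
  rw [Finset.mem_Icc] at hx
  rw [mul_assoc, mul_comm x]
  congr 4 <;> omega
end

section
/- Every finite group G of order m ≥ 2 has at most m^{log₂ m} subgroups, where log₂ denotes the logarithm to base 2 and the bound is interpreted as the real number m raised to the real power log₂ m. -/
theorem Subgroup.two_mul_card_le_of_lt {G : Type*} [Group G] [Finite G] {K H : Subgroup G}
    (h : K < H) : 2 * Nat.card K ≤ Nat.card H := by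
  obtain ⟨c, hc⟩ := Subgroup.card_dvd_of_le h.le
  have hne : c ≠ 1 := fun h1 => h.ne (Subgroup.eq_of_le_of_card_ge h.le (by simp [hc, h1]))
  have hpos : 0 < Nat.card H := Nat.card_pos
  have hc0 : c ≠ 0 := fun h0 => by simp [hc, h0] at hpos
  have hc2 : 2 ≤ c := by omega
  rw [hc, mul_comm]
  exact Nat.mul_le_mul_left _ hc2

theorem Subgroup.exists_closure_range_le {G : Type*} [Group G] [Finite G] (H : Subgroup G)
    (n : ℕ) : ∃ f : Fin n → G, Subgroup.closure (Set.range f) ≤ H ∧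
      (Subgroup.closure (Set.range f) = H ∨
        2 ^ n ≤ Nat.card (Subgroup.closure (Set.range f))) := by
  induction n with
  | zero => exact ⟨Fin.elim0, by simp, Or.inr (by simp)⟩
  | succ n ih =>
    obtain ⟨f, hle, hf⟩ := ih
    have hmono (g : G) : Subgroup.closure (Set.range f) ≤
        Subgroup.closure (Set.range (Fin.cons g f : Fin (n + 1) → G)) := by
      rw [Fin.range_cons]
      exact Subgroup.closure_mono (Set.subset_insert _ _)
    have hcons {g : G} (hg : g ∈ H) :
        Subgroup.closure (Set.range (Fin.cons g f : Fin (n + 1) → G)) ≤ H := by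
      rw [Fin.range_cons, Subgroup.closure_le, Set.insert_subset_iff]
      exact ⟨hg, (Subgroup.closure_le H).mp hle⟩
    by_cases heq : Subgroup.closure (Set.range f) = H
    · have h1 := hcons H.one_mem
      exact ⟨Fin.cons 1 f, h1, Or.inl (h1.antisymm (heq.symm.le.trans (hmono 1)))⟩
    · obtain ⟨g, hgH, hg⟩ := SetLike.exists_of_lt (lt_of_le_of_ne hle heq)
      refine ⟨Fin.cons g f, hcons hgH, Or.inr ?_⟩
      have hlt : Subgroup.closure (Set.range f) <
          Subgroup.closure (Set.range (Fin.cons g f : Fin (n + 1) → G)) :=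
        SetLike.lt_iff_le_and_exists.mpr
          ⟨hmono g, g, Subgroup.subset_closure ⟨0, Fin.cons_zero _ _⟩, hg⟩
      have := Subgroup.two_mul_card_le_of_lt hlt
      have := hf.resolve_left heq
      rw [pow_succ]
      omega

theorem Subgroup.exists_closure_range_eq {G : Type*} [Group G] [Finite G] (H : Subgroup G)
    {n : ℕ} (hn : Nat.card H < 2 ^ (n + 1)) :
    ∃ f : Fin n → G, Subgroup.closure (Set.range f) = H := by
  obtain ⟨f, hle, hf⟩ := H.exists_closure_range_le n
  refine ⟨f, by_contra fun hne => ?_⟩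
  have := Subgroup.two_mul_card_le_of_lt (lt_of_le_of_ne hle hne)
  have := hf.resolve_left hne
  rw [pow_succ] at hn
  omega

theorem Subgroup.card_subgroup_le_card_pow_log (G : Type*) [Group G] [Finite G] :
    Nat.card (Subgroup G) ≤ Nat.card G ^ Nat.log 2 (Nat.card G) := by
  have hsurj : Function.Surjective
      fun f : Fin (Nat.log 2 (Nat.card G)) → G => Subgroup.closure (Set.range f) :=
    fun H => H.exists_closure_range_eq
      (H.card_le_card_group.trans_lt (Nat.lt_pow_succ_log_self one_lt_two _))
  simpa [Nat.card_fun] using Nat.card_le_card_of_surjective _ hsurj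

/-- Every finite group of order `m ≥ 2` has at most `m^(log₂ m)` subgroups, where the bound
is the real number `m` raised to the real power `log₂ m`. -/
theorem card_subgroup_le_rpow_logb
    (G : Type*) [Group G] [Finite G] (m : ℕ) (hm : Nat.card G = m) (hm2 : 2 ≤ m) :
    (Nat.card (Subgroup G) : ℝ) ≤ (m : ℝ) ^ Real.logb 2 (m : ℝ) := by
  subst hm
  calc (Nat.card (Subgroup G) : ℝ)
      ≤ (Nat.card G : ℝ) ^ Nat.log 2 (Nat.card G) := by
        exact_mod_cast Subgroup.card_subgroup_le_card_pow_log G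
    _ = (Nat.card G : ℝ) ^ (Nat.log 2 (Nat.card G) : ℝ) := (Real.rpow_natCast _ _).symm
    _ ≤ (Nat.card G : ℝ) ^ Real.logb 2 (Nat.card G : ℝ) :=
        Real.rpow_le_rpow_of_exponent_le (by exact_mod_cast one_le_two.trans hm2)
          (by exact_mod_cast Real.natLog_le_logb (Nat.card G) 2)
end
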